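/- arXiv:1810.10803 — 4 statements merged into one kernel-verified Lean document; each statement's English description precedes it below -/
import Mathlib

section
/- Let a and b be odd positive integers, c an even positive integer, and let l and m be non-negative integers with (l,m) ≠ (0,0). Then for all but finitely many primes p, the sum, over all tuples (m₀, m₁, …, m_{2l}) of non-negative integers with m₀ + m₁ + ⋯ + m_{2l} = m, of the truncated multiple zeta-star value Z*_p({c}^{m₀}, a, {c}^{m₁}, b, {c}^{m₂}, …, {c}^{m_{2l-2}}, a, {c}^{m_{2l-1}}, b, {c}^{m_{2l}}) has p-adic valuation at least 1 (i.e., the sum is congruent to 0 modulo p). -/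
/-- `ZAux N ks a = ∑_{a ≤ n₁ < ⋯ < n_r ≤ N} ∏ᵢ 1/nᵢ^{kᵢ}` for `ks = (k₁,…,k_r)`. -/
def ZAux (N : ℕ) : List ℕ → ℕ → ℚ
  | [], _ => 1
  | k :: ks, a => ∑ n ∈ Finset.Icc a N, ((n : ℚ) ^ k)⁻¹ * ZAux N ks (n + 1)

/-- Truncated multiple zeta value `Z_p(k₁,…,k_r) = ∑_{1 ≤ n₁ < ⋯ < n_r ≤ p-1} 1/(n₁^{k₁}⋯n_r^{k_r})`. -/
def Z (p : ℕ) (ks : List ℕ) : ℚ := ZAux (p - 1) ks 1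

/-- `ZsAux N ks a = ∑_{a ≤ n₁ ≤ ⋯ ≤ n_r ≤ N} ∏ᵢ 1/nᵢ^{kᵢ}`. -/
def ZsAux (N : ℕ) : List ℕ → ℕ → ℚ
  | [], _ => 1
  | k :: ks, a => ∑ n ∈ Finset.Icc a N, ((n : ℚ) ^ k)⁻¹ * ZsAux N ks n

/-- Truncated multiple zeta-star value. -/
def Zstar (p : ℕ) (ks : List ℕ) : ℚ := ZsAux (p - 1) ks 1

/-- `α ≡ β (mod p^e)` for rationals: the `p`-adic valuation of `α - β` is at least `e`,
expressed via the `p`-adic norm. -/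
def congrMod (p e : ℕ) (α β : ℚ) : Prop := padicNorm p (α - β) ≤ (p : ℚ) ^ (-(e : ℤ))

/-- `gapIndex a b c [m₀, m₁, …, m_{2l}]` is the index
`{c}^{m₀}, a, {c}^{m₁}, b, {c}^{m₂}, …, a, {c}^{m_{2l-1}}, b, {c}^{m_{2l}}`. -/
def gapIndex (a b c : ℕ) : List ℕ → List ℕ
  | [] => []
  | [m0] => List.replicate m0 c
  | m0 :: m1 :: rest =>
      List.replicate m0 c ++ a :: (List.replicate m1 c ++ b :: gapIndex a b c rest)

theorem Finset.Nat.sum_antidiagonalTuple_succ {M : Type*} [AddCommMonoid M] (k n : ℕ)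
    (f : (Fin (k + 1) → ℕ) → M) :
    ∑ x ∈ antidiagonalTuple (k + 1) n, f x =
      ∑ ij ∈ antidiagonal n, ∑ x ∈ antidiagonalTuple k ij.2, f (Fin.cons ij.1 x) := by
  change ((List.Nat.antidiagonalTuple (k + 1) n).map f).sum =
    ((List.Nat.antidiagonal n).map fun ij =>
      ((List.Nat.antidiagonalTuple k ij.2).map fun x => f (Fin.cons ij.1 x)).sum).sum
  rw [List.Nat.antidiagonalTuple, List.map_flatMap, List.flatMap_def, List.sum_flatten]
  simp [Function.comp_def]

namespace BowmanBradley

/-! ### Words obtained by inserting copies of a letter -/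

/-- The sum of `g w` over all words `w` obtained by inserting `m` letters `c` into the word `xs`,
indexed by the numbers of letters inserted into each gap. -/
def insertSum {M : Type*} [AddCommMonoid M] (c : ℕ) (g : List ℕ → M) : List ℕ → ℕ → M
  | [], 0 => g []
  | x :: xs, 0 => insertSum c (fun w => g (x :: w)) xs 0
  | [], m + 1 => insertSum c (fun w => g (c :: w)) [] m
  | x :: xs, m + 1 =>
      insertSum c (fun w => g (c :: w)) (x :: xs) m +
        insertSum c (fun w => g (x :: w)) xs (m + 1)
  termination_by xs m => xs.length + m

section AddCommMonoid

variable {M : Type*} [AddCommMonoid M] (c : ℕ)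

theorem insertSum_add (g g' : List ℕ → M) (xs : List ℕ) (m : ℕ) :
    insertSum c (fun w => g w + g' w) xs m = insertSum c g xs m + insertSum c g' xs m := by
  fun_induction insertSum c g xs m generalizing g' with
  | case1 => simp [insertSum]
  | case2 g x xs ih => simp [insertSum, ih]
  | case3 g m ih => simp [insertSum, ih]
  | case4 g x xs m ih₁ ih₂ =>
    simp only [insertSum, ih₁, ih₂]
    exact add_add_add_comm _ _ _ _

theorem insertSum_zero (xs : List ℕ) (m : ℕ) :
    insertSum c (fun _ => (0 : M)) xs m = 0 := by
  generalize hg : (fun _ => (0 : M)) = g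
  fun_induction insertSum c g xs m <;> subst hg <;> simp_all

theorem insertSum_nil (g : List ℕ → M) (m : ℕ) :
    insertSum c g [] m = g (List.replicate m c) := by
  induction m generalizing g with
  | zero => simp [insertSum]
  | succ m ih => simp [insertSum, ih, List.replicate_succ]

theorem insertSum_cons (g : List ℕ → M) (x : ℕ) (xs : List ℕ) (m : ℕ) :
    insertSum c g (x :: xs) m =
      ∑ ij ∈ Finset.HasAntidiagonal.antidiagonal m,
        insertSum c (fun w => g (List.replicate ij.1 c ++ x :: w)) xs ij.2 := by
  induction m generalizing g with
  | zero => simp [insertSum]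
  | succ m ih =>
    rw [insertSum, ih, Finset.Nat.antidiagonal_succ, Finset.sum_cons, Finset.sum_map, add_comm]
    simp [List.replicate_succ]

/-- The word `a, b, a, b, …, a, b` with `l` letters `a` and `l` letters `b`. -/
def alternating (a b : ℕ) : ℕ → List ℕ
  | 0 => []
  | l + 1 => a :: b :: alternating a b l

theorem sum_gapIndex (a b : ℕ) (g : List ℕ → M) (l m : ℕ) :
    ∑ f ∈ Finset.Nat.antidiagonalTuple (2 * l + 1) m, g (gapIndex a b c (List.ofFn f)) =
      insertSum c g (alternating a b l) m := by
  induction l generalizing g m with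
  | zero => simp [Finset.Nat.antidiagonalTuple_one, alternating, insertSum_nil, gapIndex]
  | succ l ih =>
    rw [alternating, insertSum_cons, show 2 * (l + 1) + 1 = (2 * l + 1) + 1 + 1 by ring,
      Finset.Nat.sum_antidiagonalTuple_succ]
    refine Finset.sum_congr rfl fun i _ => ?_
    rw [Finset.Nat.sum_antidiagonalTuple_succ, insertSum_cons]
    refine Finset.sum_congr rfl fun j _ => ?_
    rw [← ih]
    simp only [List.ofFn_cons, gapIndex]

end AddCommMonoid

theorem insertSum_mul_left {K : Type*} [Semiring K] (c : ℕ) (r : K) (g : List ℕ → K)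
    (xs : List ℕ) (m : ℕ) :
    insertSum c (fun w => r * g w) xs m = r * insertSum c g xs m := by
  fun_induction insertSum c g xs m <;> simp_all [insertSum, mul_add]

/-! ### Star sums in a field and their generating series -/

section Field

variable {K : Type*} [Field K] (N : ℕ)

/-- The analogue of `ZsAux` in an arbitrary field. -/
def starSum : List ℕ → ℕ → K
  | [], _ => 1
  | k :: ks, n => ∑ i ∈ Finset.Icc n N, ((i : K) ^ k)⁻¹ * starSum ks i

theorem starSum_cons {n : ℕ} (hn : n ≤ N) (k : ℕ) (ks : List ℕ) :
    (starSum N (k :: ks) n : K) =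
      ((n : K) ^ k)⁻¹ * starSum N ks n + starSum N (k :: ks) (n + 1) := by
  rw [starSum, starSum, ← Finset.add_sum_Ioc_eq_sum_Icc hn,
    Finset.Icc_add_one_left_eq_Ioc]

theorem starSum_cons_succ_self (k : ℕ) (ks : List ℕ) :
    (starSum N (k :: ks) (N + 1) : K) = 0 := by
  simp [starSum]

/-- The star sums with lower bound `n`, summed over all insertions of `m` letters `c`. -/
def starInsertSum (c : ℕ) (xs : List ℕ) (m n : ℕ) : K :=
  insertSum c (fun w => starSum N w n) xs m

variable (c : ℕ)

theorem starInsertSum_nil_zero (n : ℕ) : (starInsertSum N c [] 0 n : K) = 1 := by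
  simp [starInsertSum, insertSum, starSum]

theorem starInsertSum_cons_zero {n : ℕ} (hn : n ≤ N) (x : ℕ) (xs : List ℕ) :
    (starInsertSum N c (x :: xs) 0 n : K) =
      ((n : K) ^ x)⁻¹ * starInsertSum N c xs 0 n + starInsertSum N c (x :: xs) 0 (n + 1) := by
  simp only [starInsertSum, insertSum, starSum_cons N hn, insertSum_add, insertSum_mul_left]

theorem starInsertSum_nil_succ {n : ℕ} (hn : n ≤ N) (m : ℕ) :
    (starInsertSum N c [] (m + 1) n : K) =
      ((n : K) ^ c)⁻¹ * starInsertSum N c [] m n + starInsertSum N c [] (m + 1) (n + 1) := by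
  simp only [starInsertSum, insertSum, starSum_cons N hn, insertSum_add, insertSum_mul_left]

theorem starInsertSum_cons_succ {n : ℕ} (hn : n ≤ N) (x : ℕ) (xs : List ℕ) (m : ℕ) :
    (starInsertSum N c (x :: xs) (m + 1) n : K) =
      ((n : K) ^ c)⁻¹ * starInsertSum N c (x :: xs) m n +
        ((n : K) ^ x)⁻¹ * starInsertSum N c xs (m + 1) n +
          starInsertSum N c (x :: xs) (m + 1) (n + 1) := by
  simp only [starInsertSum]
  simp only [insertSum, starSum_cons N hn, insertSum_add, insertSum_mul_left]
  ring

theorem starInsertSum_cons_succ_self (x : ℕ) (xs : List ℕ) (m : ℕ) :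
    (starInsertSum N c (x :: xs) m (N + 1) : K) = 0 := by
  cases m <;> simp [starInsertSum, insertSum, starSum_cons_succ_self, insertSum_zero]

theorem starInsertSum_nil_succ_self (m : ℕ) :
    (starInsertSum N c [] (m + 1) (N + 1) : K) = 0 := by
  simp [starInsertSum, insertSum, starSum_cons_succ_self, insertSum_zero]

open PowerSeries

/-- The inner variable, which counts the letters `c`. -/
noncomputable abbrev t : K⟦X⟧⟦X⟧ := C X

/-- The outer variable, which counts the pairs of letters `a`, `b`. -/
noncomputable abbrev u : K⟦X⟧⟦X⟧ := X

/-- The embedding of the constants. -/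
noncomputable abbrev const : K →+* K⟦X⟧⟦X⟧ := C.comp C

variable (a b : ℕ)

/-- The generating series of the star sums with lower bound `n` over the words
`a, b, …, a, b` with letters `c` inserted. -/
noncomputable def evenSeries (n : ℕ) : K⟦X⟧⟦X⟧ :=
  mk fun l => mk fun m => starInsertSum N c (alternating a b l) m n

/-- The generating series of the star sums with lower bound `n` over the words
`b, a, b, …, a, b` with letters `c` inserted. -/
noncomputable def oddSeries (n : ℕ) : K⟦X⟧⟦X⟧ :=
  mk fun l => mk fun m => starInsertSum N c (b :: alternating a b l) m n

theorem evenSeries_eq {n : ℕ} (hn : n ≤ N) :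
    (evenSeries N c a b n : K⟦X⟧⟦X⟧) =
      evenSeries N c a b (n + 1) + t * (const ((n : K) ^ c)⁻¹ * evenSeries N c a b n) +
        u * (const ((n : K) ^ a)⁻¹ * oddSeries N c a b n) := by
  ext l m
  rcases l with _ | l <;> rcases m with _ | m <;>
    simp only [map_add, t, u, const, RingHom.comp_apply, coeff_C_mul, coeff_succ_X_mul,
      coeff_zero_X_mul, evenSeries, oddSeries, coeff_mk, alternating, map_zero]
  · simp [starInsertSum_nil_zero]
  · rw [starInsertSum_nil_succ N c hn]; ring
  · rw [starInsertSum_cons_zero N c hn]; ring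
  · rw [starInsertSum_cons_succ N c hn]; ring

theorem oddSeries_eq {n : ℕ} (hn : n ≤ N) :
    (oddSeries N c a b n : K⟦X⟧⟦X⟧) =
      oddSeries N c a b (n + 1) + t * (const ((n : K) ^ c)⁻¹ * oddSeries N c a b n) +
        const ((n : K) ^ b)⁻¹ * evenSeries N c a b n := by
  ext l m
  rcases m with _ | m <;>
    simp only [map_add, t, const, RingHom.comp_apply, coeff_C_mul, coeff_succ_X_mul,
      coeff_zero_X_mul, evenSeries, oddSeries, coeff_mk]
  · rw [starInsertSum_cons_zero N c hn]; ring
  · rw [starInsertSum_cons_succ N c hn]; ring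

theorem evenSeries_succ_self : (evenSeries N c a b (N + 1) : K⟦X⟧⟦X⟧) = 1 := by
  ext l m
  rcases l with _ | l <;> rcases m with _ | m <;>
    simp [evenSeries, alternating, starInsertSum_cons_succ_self, starInsertSum_nil_succ_self,
      starInsertSum_nil_zero, coeff_one]

/-- The determinant of the transfer matrix at the reciprocal `x` of an index. -/
noncomputable def transferDet (x : K) : K⟦X⟧⟦X⟧ :=
  (1 - t * const (x ^ c)) ^ 2 - u * const (x ^ (a + b))

variable {a b c}

theorem transferDet_neg (hc : Even c) (hab : Even (a + b)) (x : K) :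
    transferDet c a b (-x) = transferDet c a b x := by
  simp only [transferDet, hc.neg_pow, hab.neg_pow]

theorem constantCoeff_transferDet (x : K) :
    constantCoeff (constantCoeff (transferDet c a b x)) = 1 := by
  simp [transferDet]

end Field

/-! ### The weight filtration -/

section Weight

open PowerSeries

variable {K : Type*} [Field K]

/-- The ideal of series all of whose terms `t ^ m * u ^ l` have weight `c * m + d * l ≥ W`. -/
def weightIdeal (K : Type*) [Field K] (c d W : ℕ) : Ideal K⟦X⟧⟦X⟧ where
  carrier := {F | ∀ l m, c * m + d * l < W → coeff m (coeff l F) = 0}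
  add_mem' hF hG l m h := by simp [hF l m h, hG l m h]
  zero_mem' l m _ := by simp
  smul_mem' F G hG l m h := by
    rw [smul_eq_mul, coeff_mul, map_sum]
    refine Finset.sum_eq_zero fun i hi => ?_
    rw [coeff_mul]
    refine Finset.sum_eq_zero fun j hj => ?_
    rw [Finset.HasAntidiagonal.mem_antidiagonal] at hi hj
    rw [hG, mul_zero]
    refine lt_of_le_of_lt ?_ h
    gcongr <;> omega

variable {c d W : ℕ}

theorem mem_weightIdeal {F : K⟦X⟧⟦X⟧} :
    F ∈ weightIdeal K c d W ↔ ∀ l m, c * m + d * l < W → coeff m (coeff l F) = 0 :=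
  Iff.rfl

theorem isUnit_of_constantCoeff {F : K⟦X⟧⟦X⟧} (hF : constantCoeff (constantCoeff F) ≠ 0) :
    IsUnit F := by
  rw [isUnit_iff_constantCoeff, isUnit_iff_constantCoeff]
  exact hF.isUnit

theorem sub_one_mem_of_sq_sub_one_mem (h2 : (2 : K) ≠ 0) {F : K⟦X⟧⟦X⟧}
    (hF : constantCoeff (constantCoeff F) = 1) (h : F ^ 2 - 1 ∈ weightIdeal K c d W) :
    F - 1 ∈ weightIdeal K c d W := by
  have hu : IsUnit (F + 1) := isUnit_of_constantCoeff (by simpa [hF, one_add_one_eq_two])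
  rw [← Ideal.unit_mul_mem_iff_mem _ hu]
  convert h using 1
  ring

/-- The substitution `t ↦ r ^ c * t`, `u ↦ r ^ d * u`. -/
noncomputable def weightScale (c d : ℕ) (r : K) : K⟦X⟧⟦X⟧ →+* K⟦X⟧⟦X⟧ :=
  (rescale (C (r ^ d))).comp (PowerSeries.map (rescale (r ^ c)))

theorem coeff_weightScale (r : K) (F : K⟦X⟧⟦X⟧) (l m : ℕ) :
    coeff m (coeff l (weightScale c d r F)) = r ^ (c * m + d * l) * coeff m (coeff l F) := by
  simp only [weightScale, RingHom.comp_apply, coeff_rescale, coeff_map, ← map_pow, coeff_C_mul]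
  ring

theorem rescale_const {R : Type*} [CommSemiring R] (r x : R) : rescale r (C x) = C x := by
  ext n
  rw [coeff_rescale, coeff_C]
  split_ifs with h <;> simp [h]

theorem weightScale_transferDet {a b : ℕ} (r x : K) :
    weightScale c (a + b) r (transferDet c a b x) = transferDet c a b (r * x) := by
  have ht : weightScale c (a + b) r t = t * const (r ^ c) := by
    simp [weightScale, t, rescale_const, mul_comm]
  have hu : weightScale c (a + b) r u = u * const (r ^ (a + b)) := by
    simp [weightScale, u, mul_comm]
  have hc (y : K) : weightScale c (a + b) r (const y) = const y := by
    simp [weightScale, rescale_const]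
  simp only [transferDet, map_sub, map_mul, map_pow, map_one, ht, hu, hc, mul_pow]
  ring

end Weight

/-! ### Reflection modulo a prime -/

section ZMod

open PowerSeries

variable {p : ℕ} [Fact p.Prime] {a b c : ℕ}

theorem series_reflect (ha : Odd a) (hb : Odd b) (hc : Even c) {h k : ℕ} (hp : p = 2 * h + 1)
    (hk : k ≤ h) :
    let E : (ZMod p)⟦X⟧⟦X⟧ := ∏ n ∈ Finset.Ico (k + 1) (h + 1), transferDet c a b (n : ZMod p)⁻¹
    evenSeries (p - 1) c a b (p - k) = E * evenSeries (p - 1) c a b (k + 1) ∧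
      oddSeries (p - 1) c a b (p - k) = E * oddSeries (p - 1) c a b (k + 1) := by
  induction hk using Nat.decreasingInduction with
  | self =>
    simp [show p - h = h + 1 by omega]
  | of_succ k hk ih =>
    obtain ⟨ih₀, ih₁⟩ := ih
    have hn : k + 1 ≤ p - 1 := by omega
    have hr : p - (k + 1) ≤ p - 1 := by omega
    have hcast : ((p - (k + 1) : ℕ) : ZMod p) = -((k + 1 : ℕ) : ZMod p) := by
      rw [Nat.cast_sub (by omega), CharP.cast_eq_zero, zero_sub]
    have e₁ := evenSeries_eq (K := ZMod p) (p - 1) c a b hn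
    have o₁ := oddSeries_eq (K := ZMod p) (p - 1) c a b hn
    have e₂ := evenSeries_eq (K := ZMod p) (p - 1) c a b hr
    have o₂ := oddSeries_eq (K := ZMod p) (p - 1) c a b hr
    rw [hcast, hc.neg_pow, show p - (k + 1) + 1 = p - k by omega] at e₂ o₂
    rw [ha.neg_pow, inv_neg, map_neg] at e₂
    rw [hb.neg_pow, inv_neg, map_neg] at o₂
    rw [ih₀, ih₁] at e₂ o₂
    rw [Finset.prod_eq_prod_Ico_succ_bot (by omega : k + 1 < h + 1)]
    generalize ∏ n ∈ Finset.Ico (k + 1 + 1) (h + 1), transferDet c a b (n : ZMod p)⁻¹ = E at *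
    simp only [transferDet, pow_add _ a b, map_mul, inv_pow]
    generalize const ((k + 1 : ℕ) ^ a : ZMod p)⁻¹ = xa at *
    generalize const ((k + 1 : ℕ) ^ b : ZMod p)⁻¹ = xb at *
    generalize const ((k + 1 : ℕ) ^ c : ZMod p)⁻¹ = xc at *
    constructor
    · linear_combination -e₂ - (1 - t * xc) * E * e₁ - u * xa * E * o₁
    · linear_combination -o₂ - (1 - t * xc) * E * o₁ - xb * E * e₁

theorem prod_units_eq_prod_Ico {M : Type*} [CommMonoid M] (f : ZMod p → M) :
    ∏ x : (ZMod p)ˣ, f x = ∏ n ∈ Finset.Ico 1 p, f (n : ZMod p)⁻¹ := by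
  rw [← Equiv.prod_comp (Equiv.inv (ZMod p)ˣ)]
  refine Finset.prod_bij (fun x _ => (x : ZMod p).val) (fun x _ => ?_) (fun x _ y _ hxy => ?_)
    (fun n hn => ?_) (fun x _ => ?_)
  · rw [Finset.mem_Ico, Nat.one_le_iff_ne_zero, ne_eq, ZMod.val_eq_zero]
    exact ⟨x.ne_zero, ZMod.val_lt _⟩
  · exact Units.ext (ZMod.val_injective p hxy)
  · rw [Finset.mem_Ico] at hn
    have hn0 : (n : ZMod p) ≠ 0 := by
      rw [ne_eq, CharP.cast_eq_zero_iff (ZMod p) p]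
      exact Nat.not_dvd_of_pos_of_lt hn.1 hn.2
    exact ⟨Units.mk0 _ hn0, Finset.mem_univ _, by simp [ZMod.val_natCast_of_lt hn.2]⟩
  · rw [ZMod.natCast_zmod_val, Equiv.inv_apply, Units.val_inv_eq_inv_val]

theorem sq_prod_transferDet (hc : Even c) (hab : Even (a + b)) {h : ℕ} (hp : p = 2 * h + 1) :
    (∏ n ∈ Finset.Ico 1 (h + 1), transferDet c a b (n : ZMod p)⁻¹) ^ 2 =
      ∏ x : (ZMod p)ˣ, transferDet c a b (x : ZMod p) := by
  have key : ∏ n ∈ Finset.Ico (h + 1) p, transferDet c a b (n : ZMod p)⁻¹ =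
      ∏ n ∈ Finset.Ico 1 (h + 1), transferDet c a b (n : ZMod p)⁻¹ := by
    have := Finset.prod_Ico_reflect (fun n : ℕ => transferDet c a b (n : ZMod p)⁻¹) 1
      (m := h + 1) (n := p) (by omega)
    rw [show p + 1 - (h + 1) = h + 1 by omega, Nat.add_sub_cancel] at this
    rw [← this]
    refine Finset.prod_congr rfl fun n hn => ?_
    rw [Finset.mem_Ico] at hn
    rw [Nat.cast_sub (by omega), CharP.cast_eq_zero, zero_sub, inv_neg, transferDet_neg hc hab]
  rw [prod_units_eq_prod_Ico (transferDet c a b),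
    ← Finset.prod_Ico_consecutive _ (by omega : 1 ≤ h + 1) (by omega : h + 1 ≤ p), key, sq]

theorem prod_transferDet_sub_one_mem (hc : 0 < c) (hab : 0 < a + b) :
    ∏ x : (ZMod p)ˣ, transferDet c a b (x : ZMod p) - 1 ∈
      weightIdeal (ZMod p) c (a + b) (p - 1) := by
  rw [mem_weightIdeal]
  intro l m hlm
  obtain ⟨r, hr⟩ := IsCyclic.exists_ofOrder_eq_natCard (α := (ZMod p)ˣ)
  rw [Nat.card_eq_fintype_card, ZMod.card_units] at hr
  have hE : weightScale c (a + b) (r : ZMod p) (∏ x : (ZMod p)ˣ, transferDet c a b (x : ZMod p)) =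
      ∏ x : (ZMod p)ˣ, transferDet c a b (x : ZMod p) := by
    simp only [map_prod, weightScale_transferDet, ← Units.val_mul]
    exact Equiv.prod_comp (Equiv.mulLeft r) fun x : (ZMod p)ˣ => transferDet c a b (x : ZMod p)
  have hco := coeff_weightScale (c := c) (r : ZMod p)
    (∏ x : (ZMod p)ˣ, transferDet c a b (x : ZMod p)) (d := a + b) l m
  rw [hE] at hco
  rcases Nat.eq_zero_or_pos (c * m + (a + b) * l) with h0 | h0
  · obtain ⟨rfl, rfl⟩ : m = 0 ∧ l = 0 := by
      rwa [Nat.add_eq_zero_iff, mul_eq_zero_iff_left hc.ne', mul_eq_zero_iff_left hab.ne'] at h0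
    simp [map_prod, constantCoeff_transferDet]
  · have hne : (r : ZMod p) ^ (c * m + (a + b) * l) ≠ 1 := by
      rw [← Units.val_pow_eq_pow_val, ne_eq, Units.val_eq_one]
      exact pow_ne_one_of_lt_orderOf h0.ne' (hr ▸ hlm)
    have h1 : coeff m (coeff l (1 : (ZMod p)⟦X⟧⟦X⟧)) = 0 := by
      rcases l with _ | l <;> rcases m with _ | m <;> simp_all [coeff_one]
    rw [map_sub, map_sub, h1, sub_zero]
    by_contra hx
    exact hne (mul_right_cancel₀ hx (by rw [one_mul]; exact hco.symm))

theorem starInsertSum_alternating_eq_zero (ha : Odd a) (hb : Odd b) (hc : Even c) (hc0 : 0 < c)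
    {l m : ℕ} (h0 : (l, m) ≠ (0, 0)) (hlm : c * m + (a + b) * l < p - 1) :
    (starInsertSum (p - 1) c (alternating a b l) m 1 : ZMod p) = 0 := by
  have hp2 : p ≠ 2 := by
    rintro rfl
    have : c * m + (a + b) * l = 0 := by omega
    have := ha.pos
    simp_all [hc0.ne']
  obtain ⟨h, hp⟩ := (Fact.out : p.Prime).odd_of_ne_two hp2
  obtain ⟨hs, -⟩ := series_reflect ha hb hc hp (Nat.zero_le h)
  have hsq := sq_prod_transferDet (p := p) hc (ha.add_odd hb) hp
  rw [zero_add] at hs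
  set D := ∏ n ∈ Finset.Ico 1 (h + 1), transferDet c a b (n : ZMod p)⁻¹
  have hD : constantCoeff (constantCoeff D) = 1 := by
    simp [D, map_prod, constantCoeff_transferDet]
  have h2 : (2 : ZMod p) ≠ 0 := by
    have := (CharP.cast_eq_zero_iff (ZMod p) p 2).not.mpr fun hd =>
      hp2 ((Nat.prime_dvd_prime_iff_eq Fact.out Nat.prime_two).mp hd)
    exact_mod_cast this
  have hD1 := sub_one_mem_of_sq_sub_one_mem h2 hD
    (hsq ▸ prod_transferDet_sub_one_mem hc0 (Nat.add_pos_left ha.pos b))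
  have hone : D * evenSeries (p - 1) c a b 1 = 1 := by
    rw [← hs, show p - 0 = p - 1 + 1 by omega, evenSeries_succ_self]
  have hmem : evenSeries (p - 1) c a b 1 - 1 ∈ weightIdeal (ZMod p) c (a + b) (p - 1) := by
    rw [← Ideal.unit_mul_mem_iff_mem _ (isUnit_of_constantCoeff (by simp [hD] :
      constantCoeff (constantCoeff D) ≠ 0)), mul_sub, hone, mul_one, ← neg_sub]
    exact neg_mem hD1
  have := mem_weightIdeal.mp hmem l m hlm
  have h1 : coeff m (coeff l (1 : (ZMod p)⟦X⟧⟦X⟧)) = 0 := by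
    rcases l with _ | l <;> rcases m with _ | m <;> simp_all [coeff_one]
  rwa [map_sub, map_sub, h1, sub_zero, evenSeries, coeff_mk, coeff_mk] at this

/-! ### Reduction of rational numbers modulo a prime -/

/-- The rational number `r` is `p`-integral with residue `z`. -/
def Reduces (r : ℚ) (z : ZMod p) : Prop :=
  ∃ x : ℤ_[p], (x : ℚ_[p]) = r ∧ PadicInt.toZMod x = z

namespace Reduces

variable {r s : ℚ} {y z : ZMod p}

theorem one : Reduces 1 (1 : ZMod p) := ⟨1, by simp, by simp⟩

theorem mul (hr : Reduces r y) (hs : Reduces s z) : Reduces (r * s) (y * z) := by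
  obtain ⟨x, hx, rfl⟩ := hr
  obtain ⟨x', hx', rfl⟩ := hs
  exact ⟨x * x', by simp [hx, hx'], map_mul _ _ _⟩

theorem sum {ι : Type*} {I : Finset ι} {f : ι → ℚ} {g : ι → ZMod p}
    (h : ∀ i ∈ I, Reduces (f i) (g i)) : Reduces (∑ i ∈ I, f i) (∑ i ∈ I, g i) := by
  classical
  induction I using Finset.induction_on with
  | empty => exact ⟨0, by simp, by simp⟩
  | insert i I hi ih =>
    obtain ⟨x, hx, hx'⟩ := h i (Finset.mem_insert_self i I)
    obtain ⟨y, hy, hy'⟩ := ih fun j hj => h j (Finset.mem_insert_of_mem hj)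
    rw [Finset.sum_insert hi, Finset.sum_insert hi]
    exact ⟨x + y, by simp [hx, hy], by rw [map_add, hx', hy']⟩

theorem inv_natCast {n : ℕ} (hn : ¬ p ∣ n) : Reduces (n : ℚ)⁻¹ ((n : ZMod p)⁻¹) := by
  have hu : ‖(n : ℤ_[p])‖ = 1 := by
    refine le_antisymm (PadicInt.norm_le_one _) (not_lt.mp fun hlt => hn ?_)
    rw [PadicInt.norm_def] at hlt
    exact_mod_cast (Padic.norm_natCast_lt_one_iff).mp (by simpa using hlt)
  have hmul := PadicInt.mul_inv hu
  refine ⟨(n : ℤ_[p]).inv, ?_, ?_⟩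
  · have := congrArg ((↑) : ℤ_[p] → ℚ_[p]) hmul
    push_cast at this ⊢
    exact eq_inv_of_mul_eq_one_right this
  · have := congrArg PadicInt.toZMod hmul
    rw [map_mul, map_natCast, map_one] at this
    exact eq_inv_of_mul_eq_one_right this

theorem congrMod_zero (hr : Reduces r (0 : ZMod p)) : congrMod p 1 r 0 := by
  obtain ⟨x, hx, hx0⟩ := hr
  have hmem : x ∈ Ideal.span {(p : ℤ_[p]) ^ 1} := by
    rw [pow_one, ← PadicInt.maximalIdeal_eq_span_p, ← PadicInt.ker_toZMod]
    exact hx0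
  have := (PadicInt.norm_le_pow_iff_mem_span_pow x 1).mpr hmem
  rw [PadicInt.norm_def, hx, Padic.eq_padicNorm] at this
  rw [congrMod, sub_zero]
  rw [← Rat.cast_le (K := ℝ)]
  push_cast at this ⊢
  exact this

theorem zsAux (ks : List ℕ) {n : ℕ} (hn : 0 < n) :
    Reduces (ZsAux (p - 1) ks n) (starSum (p - 1) ks n : ZMod p) := by
  induction ks generalizing n with
  | nil => exact one
  | cons k ks ih =>
    refine sum fun i hi => ?_
    rw [Finset.mem_Icc] at hi
    have hp := (Fact.out : p.Prime)
    have hi' : ¬ p ∣ i ^ k := fun hd =>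
      Nat.not_dvd_of_pos_of_lt (by omega) (by have := hp.pos; omega) (hp.dvd_of_dvd_pow hd)
    exact mul (by simpa using inv_natCast hi') (ih (by omega))

end Reduces

end ZMod

end BowmanBradley

/-- Saito–Wakabayashi: the Bowman–Bradley type sum of finite multiple zeta-star values in 𝒜₁
vanishes. -/
theorem stmt3 (a b c : ℕ) (ha : Odd a) (ha0 : 0 < a) (hb : Odd b) (hb0 : 0 < b)
    (hc : Even c) (hc0 : 0 < c) (l m : ℕ) (h : (l, m) ≠ (0, 0)) :
    ∀ᶠ p in Filter.cofinite, p.Prime →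
      congrMod p 1
        (∑ f ∈ Finset.Nat.antidiagonalTuple (2 * l + 1) m,
          Zstar p (gapIndex a b c (List.ofFn f)))
        0 := by
  rw [Nat.cofinite_eq_atTop]
  filter_upwards [Filter.eventually_gt_atTop (c * m + (a + b) * l + 1)] with p hlt hp
  have : Fact p.Prime := ⟨hp⟩
  refine BowmanBradley.Reduces.congrMod_zero ?_
  rw [← BowmanBradley.starInsertSum_alternating_eq_zero (p := p) ha hb hc hc0 h (by omega),
    BowmanBradley.starInsertSum, ← BowmanBradley.sum_gapIndex]
  exact BowmanBradley.Reduces.sum fun f _ => BowmanBradley.Reduces.zsAux _ one_pos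
end

section
/- For non-negative integers l and m, the sum, over all tuples (m₀, m₁, …, m_{2l}) of non-negative integers with m₀ + m₁ + ⋯ + m_{2l} = m, of the multiple zeta values ζ({2}^{m₀}, 1, {2}^{m₁}, 3, {2}^{m₂}, …, {2}^{m_{2l-2}}, 1, {2}^{m_{2l-1}}, 3, {2}^{m_{2l}}) equals C(2l+m, 2l) · π^{4l+2m} / ((2l+1) · (4l+2m+1)!), where C(n,k) denotes the binomial coefficient. (For (l,m) = (0,0) the left-hand side is ζ(∅) = 1.) -/
/-- The multiple zeta value `ζ(k₁,…,k_r) = ∑_{1 ≤ n₁ < ⋯ < n_r} 1/(n₁^{k₁}⋯n_r^{k_r})`,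
with `ζ(∅) = 1`. -/
noncomputable def mzv (ks : List ℕ) : ℝ :=
  ∑' n : {f : Fin ks.length → ℕ+ // StrictMono f},
    ∏ i : Fin ks.length, ((n.1 i : ℝ) ^ ks.get i)⁻¹

open Finset in
/-- The coefficient of `t ^ n` in the multiple polylogarithm `∑ t ^ n_r / (n₁^{k₁}⋯n_r^{k_r})`
(sum over `0 < n₁ < ⋯ < n_r`) whose index is listed in reverse order, `[k_r, …, k₁]`. -/
noncomputable def polylogCoeff : List ℕ → ℕ → NNReal
  | [], n => if n = 0 then 1 else 0
  | k :: r, n => ((n : NNReal) ^ k)⁻¹ * ∑ j ∈ range n, polylogCoeff r j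

open scoped ENNReal

/-- The multiple zeta value of an index, restricted to the terms with `N < n₁`. -/
noncomputable def mzvTail : List ℕ → ℕ → ℝ≥0∞
  | [], _ => 1
  | k :: ks, N => ∑' n : ℕ, if N < n then (((n : NNReal) ^ k)⁻¹ : NNReal) * mzvTail ks n else 0

theorem strictMono_cons_iff_forall_lt {r N : ℕ} (a : ℕ+) (f : Fin r → ℕ+) :
    (StrictMono (Fin.cons a f : Fin (r + 1) → ℕ+) ∧
        ∀ i, N < ((Fin.cons a f : Fin (r + 1) → ℕ+) i : ℕ)) ↔
      N < (a : ℕ) ∧ StrictMono f ∧ ∀ i, (a : ℕ) < f i := by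
  constructor
  · rintro ⟨h₁, h₂⟩
    refine ⟨by simpa using h₂ 0, fun i j hij => ?_, fun i => ?_⟩
    · simpa using h₁ (Fin.succ_lt_succ_iff.2 hij)
    · simpa using h₁ (Fin.succ_pos i)
  · rintro ⟨h₁, h₂, h₃⟩
    refine ⟨fun i j hij => ?_, fun i => ?_⟩
    · induction i using Fin.cases with
      | zero =>
        induction j using Fin.cases with
        | zero => exact absurd hij (lt_irrefl _)
        | succ j => simpa using h₃ j
      | succ i =>
        induction j using Fin.cases with
        | zero => exact absurd hij (Fin.not_lt_zero _)
        | succ j => simpa using h₂ (Fin.succ_lt_succ_iff.1 hij)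
    · induction i using Fin.cases with
      | zero => simpa using h₁
      | succ i => simpa using h₁.trans (h₃ i)

open Classical in
theorem tsum_strictMono_eq_mzvTail (ks : List ℕ) (N : ℕ) :
    (∑' f : Fin ks.length → ℕ+, if StrictMono f ∧ ∀ i, N < (f i : ℕ) then
      ((∏ i, (((f i : ℕ) : NNReal) ^ ks.get i)⁻¹ : NNReal) : ℝ≥0∞) else 0) = mzvTail ks N := by
  induction ks generalizing N with
  | nil =>
    have : Unique (Fin ([] : List ℕ).length → ℕ+) := inferInstanceAs (Unique (Fin 0 → ℕ+))
    rw [tsum_fintype, Fintype.sum_unique, if_pos ⟨fun i => i.elim0, fun i => i.elim0⟩]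
    simp [mzvTail]
  | cons k ks ih =>
    change (∑' f : Fin (ks.length + 1) → ℕ+, if StrictMono f ∧ ∀ i, N < (f i : ℕ) then
      ((∏ i : Fin (ks.length + 1), (((f i : ℕ) : NNReal) ^ (k :: ks).get i)⁻¹ : NNReal) : ℝ≥0∞)
      else 0) = _
    rw [← (Fin.consEquiv (n := ks.length) fun _ => ℕ+).tsum_eq, mzvTail]
    rw [← PNat.coe_injective.tsum_eq (f := fun n : ℕ => if N < n then
      ((((n : NNReal) ^ k)⁻¹ : NNReal) : ℝ≥0∞) * mzvTail ks n else 0)]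
    · simp_rw [← ih, ← ENNReal.tsum_mul_left, Fin.consEquiv, Equiv.coe_fn_mk,
        strictMono_cons_iff_forall_lt, Fin.prod_univ_succ]
      rw [ENNReal.tsum_prod (f := fun (a : ℕ+) (f : Fin ks.length → ℕ+) =>
        if N < (a : ℕ) ∧ StrictMono f ∧ ∀ i, (a : ℕ) < f i then
          (((((Fin.cons a f : Fin (ks.length + 1) → ℕ+) 0 : ℕ) : NNReal) ^ (k :: ks).get 0)⁻¹ *
            ∏ i : Fin ks.length, ((((Fin.cons a f : Fin (ks.length + 1) → ℕ+) i.succ : ℕ) : NNReal)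
              ^ (k :: ks).get i.succ)⁻¹ : NNReal)
        else (0 : ℝ≥0∞))]
      refine tsum_congr fun a => ?_
      by_cases ha : N < (a : ℕ)
      · simp only [ha, true_and, if_true]
        refine tsum_congr fun f => ?_
        split_ifs <;> simp
      · simp [ha]
    · intro n hn
      simp only [Function.mem_support, ne_eq, ite_eq_right_iff, not_forall] at hn
      exact ⟨⟨n, by grind⟩, rfl⟩

theorem mzv_eq_toReal_mzvTail (ks : List ℕ) : mzv ks = (mzvTail ks 0).toReal := by
  classical
  rw [← tsum_strictMono_eq_mzvTail, mzv]
  have h := tsum_subtype {f : Fin ks.length → ℕ+ | StrictMono f} fun f =>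
    ((∏ i, (((f i : ℕ) : NNReal) ^ ks.get i)⁻¹ : NNReal) : ℝ≥0∞)
  have h' := congrArg ENNReal.toReal h
  rw [ENNReal.tsum_toReal_eq (by simp)] at h'
  refine Eq.trans (tsum_congr fun f => ?_) (h'.trans (congrArg _ (tsum_congr fun f => ?_)))
  · simp
  · simp [Set.indicator_apply]

theorem tsum_polylogCoeff_mul_mzvTail_cons (r ks : List ℕ) (k : ℕ) :
    ∑' n, (polylogCoeff r n : ℝ≥0∞) * mzvTail (k :: ks) n =
      ∑' n, (polylogCoeff (k :: r) n : ℝ≥0∞) * mzvTail ks n := by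
  simp_rw [mzvTail, ← ENNReal.tsum_mul_left]
  rw [ENNReal.tsum_comm]
  refine tsum_congr fun n => ?_
  rw [tsum_eq_sum (s := Finset.range n)]
  · rw [polylogCoeff]
    push_cast
    rw [Finset.mul_sum, Finset.sum_mul]
    refine Finset.sum_congr rfl fun j hj => ?_
    rw [if_pos (Finset.mem_range.1 hj)]
    ring
  · intro j hj
    simp [Finset.mem_range.not.1 hj]

theorem mzvTail_zero_eq_tsum (ks : List ℕ) :
    mzvTail ks 0 = ∑' n, (polylogCoeff ks.reverse n : ℝ≥0∞) := by
  have h : ∀ ks r : List ℕ, ∑' n, (polylogCoeff r n : ℝ≥0∞) * mzvTail ks n =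
      ∑' n, (polylogCoeff (ks.reverse ++ r) n : ℝ≥0∞) := by
    intro ks
    induction ks with
    | nil => simp [mzvTail]
    | cons k ks ih => intro r; rw [tsum_polylogCoeff_mul_mzvTail_cons, ih]; simp
  have h' := h ks []
  rw [tsum_eq_single 0 (by simp +contextual [polylogCoeff])] at h'
  simpa [polylogCoeff] using h'

theorem mzv_eq_tsum_polylogCoeff (ks : List ℕ) :
    mzv ks = ∑' n, (polylogCoeff ks.reverse n : ℝ) := by
  rw [mzv_eq_toReal_mzvTail, mzvTail_zero_eq_tsum, ENNReal.tsum_toReal_eq (by simp)]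
  simp

open Finset.HasAntidiagonal (antidiagonal)

section WordSum

variable {M : Type*} [AddCommMonoid M]

/-- The sum of `Φ w` over all words `w` that are shuffles of `[a 0, …, a (k - 1)]` with `m` copies
of the letter `c`. -/
def wordSum (c : ℕ) : ℕ → ℕ → (ℕ → ℕ) → (List ℕ → M) → M
  | 0, 0, _, Φ => Φ []
  | 0, m + 1, a, Φ => wordSum c 0 m a fun w => Φ (c :: w)
  | k + 1, 0, a, Φ => wordSum c k 0 (fun n => a (n + 1)) fun w => Φ (a 0 :: w)
  | k + 1, m + 1, a, Φ => wordSum c (k + 1) m a (fun w => Φ (c :: w)) +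
      wordSum c k (m + 1) (fun n => a (n + 1)) fun w => Φ (a 0 :: w)

theorem wordSum_zero_succ_append (c m : ℕ) (a : ℕ → ℕ) (Φ : List ℕ → M) :
    wordSum c 0 (m + 1) a Φ = wordSum c 0 m a fun w => Φ (w ++ [c]) := by
  induction m generalizing Φ with
  | zero => simp [wordSum]
  | succ m ih => rw [wordSum, ih, wordSum]; rfl

theorem wordSum_succ_zero_append (c k : ℕ) (a : ℕ → ℕ) (Φ : List ℕ → M) :
    wordSum c (k + 1) 0 a Φ = wordSum c k 0 a fun w => Φ (w ++ [a k]) := by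
  induction k generalizing a Φ with
  | zero => simp [wordSum]
  | succ k ih => rw [wordSum, ih, wordSum]; rfl

theorem wordSum_zero_succ (c m : ℕ) (a : ℕ → ℕ) (Φ : List ℕ → M) :
    wordSum c 0 (m + 1) a Φ = wordSum c 0 m a fun w => Φ (c :: w) := by
  rw [wordSum]

theorem wordSum_succ_zero (c k : ℕ) (a : ℕ → ℕ) (Φ : List ℕ → M) :
    wordSum c (k + 1) 0 a Φ = wordSum c k 0 (fun n => a (n + 1)) fun w => Φ (a 0 :: w) := by
  rw [wordSum]

theorem wordSum_succ_succ (c k m : ℕ) (a : ℕ → ℕ) (Φ : List ℕ → M) :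
    wordSum c (k + 1) (m + 1) a Φ = wordSum c (k + 1) m a (fun w => Φ (c :: w)) +
      wordSum c k (m + 1) (fun n => a (n + 1)) fun w => Φ (a 0 :: w) := by
  rw [wordSum]

theorem wordSum_succ_succ_append (c k m : ℕ) (a : ℕ → ℕ) (Φ : List ℕ → M) :
    wordSum c (k + 1) (m + 1) a Φ = wordSum c (k + 1) m a (fun w => Φ (w ++ [c])) +
      wordSum c k (m + 1) a fun w => Φ (w ++ [a k]) := by
  induction k generalizing m a Φ with
  | zero =>
    induction m generalizing Φ with
    | zero => simp [wordSum, add_comm]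
    | succ m ihm =>
      rw [wordSum_succ_succ, ihm, wordSum_zero_succ_append c (m + 1) (fun n => a (n + 1)),
        wordSum_succ_succ c 0 m a fun w => Φ (w ++ [c]), wordSum_zero_succ c (m + 1) a]
      exact add_right_comm (G := M) _ _ _
  | succ k ih =>
    induction m generalizing Φ with
    | zero =>
      rw [wordSum_succ_succ, ih, wordSum_succ_zero_append,
        wordSum_succ_zero c (k + 1) a fun w => Φ (w ++ [c]), wordSum_succ_succ c k 0 a]
      exact add_left_comm (G := M) _ _ _
    | succ m ihm =>
      rw [wordSum_succ_succ, ihm, ih (m + 1) fun n => a (n + 1),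
        wordSum_succ_succ c (k + 1) m a fun w => Φ (w ++ [c]),
        wordSum_succ_succ c k (m + 1) a]
      exact add_add_add_comm (G := M) _ _ _ _

theorem sum_antidiagonal_wordSum (c k m : ℕ) (a : ℕ → ℕ) (Φ : List ℕ → M) :
    ∑ p ∈ antidiagonal m, wordSum c k p.2 (fun n => a (n + 1))
        (fun w => Φ (List.replicate p.1 c ++ a 0 :: w)) = wordSum c (k + 1) m a Φ := by
  induction m generalizing Φ with
  | zero => simp [wordSum]
  | succ m ih =>
    rw [Finset.Nat.sum_antidiagonal_succ, wordSum, ← ih, add_comm]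
    simp [List.replicate_succ]

theorem sum_antidiagonalTuple_succ (n m : ℕ) (g : (Fin (n + 1) → ℕ) → M) :
    ∑ f ∈ Finset.Nat.antidiagonalTuple (n + 1) m, g f =
      ∑ p ∈ antidiagonal m, ∑ f ∈ Finset.Nat.antidiagonalTuple n p.2, g (Fin.cons p.1 f) := by
  rw [Finset.sum_sigma']
  refine Finset.sum_bij' (fun f _ => ⟨(f 0, ∑ i, f (Fin.succ i)), Fin.tail f⟩)
    (fun q _ => Fin.cons q.1.1 q.2) ?_ ?_ ?_ ?_ ?_
  · intro f hf
    rw [Finset.Nat.mem_antidiagonalTuple, Fin.sum_univ_succ] at hf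
    simp [Finset.Nat.mem_antidiagonalTuple, hf, Fin.tail]
  · rintro ⟨p, f⟩ hf
    simp only [Finset.mem_sigma, Finset.HasAntidiagonal.mem_antidiagonal,
      Finset.Nat.mem_antidiagonalTuple] at hf
    simp [Finset.Nat.mem_antidiagonalTuple, Fin.sum_univ_succ, hf.1, hf.2]
  · intro f hf
    simp
  · rintro ⟨⟨i, j⟩, f⟩ hf
    simp only [Finset.mem_sigma, Finset.HasAntidiagonal.mem_antidiagonal,
      Finset.Nat.mem_antidiagonalTuple] at hf
    simp [hf.2]
  · intro f hf
    simp

/-- The alternating sequence `a, b, a, b, …`. -/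
def alternating (a b n : ℕ) : ℕ := if Even n then a else b

theorem alternating_succ (a b n : ℕ) : alternating a b (n + 1) = alternating b a n := by
  simp only [alternating, Nat.even_add_one]
  split_ifs <;> simp_all

theorem wordSum_zero_left (c m : ℕ) (a : ℕ → ℕ) (Φ : List ℕ → M) :
    wordSum c 0 m a Φ = Φ (List.replicate m c) := by
  induction m generalizing Φ with
  | zero => simp [wordSum]
  | succ m ih => rw [wordSum, ih, List.replicate_succ]

theorem sum_gapIndex_eq_wordSum (a b c l m : ℕ) (Φ : List ℕ → M) :
    ∑ f ∈ Finset.Nat.antidiagonalTuple (2 * l + 1) m, Φ (gapIndex a b c (List.ofFn f)) =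
      wordSum c (2 * l) m (alternating a b) Φ := by
  induction l generalizing m Φ with
  | zero =>
    rw [wordSum_zero_left]
    simp [gapIndex]
  | succ l ih =>
    rw [show 2 * (l + 1) + 1 = (2 * l + 1) + 1 + 1 by ring, sum_antidiagonalTuple_succ,
      show 2 * (l + 1) = (2 * l + 1) + 1 by ring, ← sum_antidiagonal_wordSum]
    refine Finset.sum_congr rfl fun p _ => ?_
    simp only [alternating_succ]
    rw [sum_antidiagonalTuple_succ, ← sum_antidiagonal_wordSum]
    refine Finset.sum_congr rfl fun q _ => ?_
    simp only [alternating_succ]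
    rw [← ih]
    simp [gapIndex, alternating]

end WordSum

section EulerOperator

open PowerSeries

/-- The Euler operator `t d/dt` on formal power series. -/
noncomputable def eulerOp : Derivation ℝ ℝ⟦X⟧ ℝ⟦X⟧ := (X : ℝ⟦X⟧) • d⁄dX ℝ

theorem coeff_eulerOp (f : ℝ⟦X⟧) (n : ℕ) : coeff n (eulerOp f) = n * coeff n f := by
  rw [eulerOp, Derivation.smul_apply, smul_eq_mul]
  cases n with
  | zero => simp
  | succ n => rw [coeff_succ_X_mul, coeff_derivative]; push_cast; ring

theorem eq_of_eulerOp_eq {f g : ℝ⟦X⟧} (h : eulerOp f = eulerOp g)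
    (h₀ : constantCoeff f = constantCoeff g) : f = g := by
  ext n
  cases n with
  | zero => simpa using h₀
  | succ n =>
    have := congrArg (coeff (n + 1)) h
    rw [coeff_eulerOp, coeff_eulerOp] at this
    exact mul_left_cancel₀ (by positivity) this

/-- The formal power series `t / (1 - t)`. -/
noncomputable def geomTail : ℝ⟦X⟧ := X * PowerSeries.mk fun _ => 1

theorem coeff_geomTail_mul (f : ℝ⟦X⟧) (n : ℕ) :
    coeff n (geomTail * f) = ∑ j ∈ Finset.range n, coeff j f := by
  rw [geomTail, mul_assoc]
  cases n with
  | zero => simp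
  | succ n =>
    rw [coeff_succ_X_mul, mul_comm, coeff_mul, Finset.Nat.sum_antidiagonal_eq_sum_range_succ_mk]
    simp

/-- The multiple polylogarithm as a formal power series, with the index in reverse order. -/
noncomputable def polylog (r : List ℕ) : ℝ⟦X⟧ := PowerSeries.mk fun n => (polylogCoeff r n : ℝ)

theorem coeff_polylog (r : List ℕ) (n : ℕ) : coeff n (polylog r) = polylogCoeff r n := by
  rw [polylog, coeff_mk]

theorem polylog_nil : polylog [] = 1 := by
  ext n
  rw [coeff_polylog, polylogCoeff, coeff_one]
  split_ifs <;> simp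

theorem constantCoeff_polylog_cons (k : ℕ) (r : List ℕ) : constantCoeff (polylog (k :: r)) = 0 := by
  rw [← coeff_zero_eq_constantCoeff_apply, coeff_polylog, polylogCoeff]
  simp

theorem eulerOp_polylog_one_cons (r : List ℕ) :
    eulerOp (polylog (1 :: r)) = geomTail * polylog r := by
  ext n
  rw [coeff_eulerOp, coeff_geomTail_mul]
  simp_rw [coeff_polylog]
  rw [polylogCoeff]
  rcases eq_or_ne n 0 with rfl | hn
  · simp
  · push_cast
    field_simp

theorem eulerOp_polylog_succ_cons (k : ℕ) (r : List ℕ) :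
    eulerOp (polylog ((k + 1) :: r)) = polylog (k :: r) := by
  ext n
  rw [coeff_eulerOp]
  simp_rw [coeff_polylog]
  rw [polylogCoeff, polylogCoeff]
  rcases eq_or_ne n 0 with rfl | hn
  · simp
  · push_cast
    field_simp
    ring

end EulerOperator

section Convolution

open PowerSeries

/-- The degree `N` part of the product of `∑ z ^ i • f i` and `∑ g j`. -/
noncomputable def gradedMul (z : ℝ) (f g : ℕ → ℝ⟦X⟧) (N : ℕ) : ℝ⟦X⟧ :=
  ∑ p ∈ antidiagonal N, z ^ p.1 • (f p.1 * g p.2)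

theorem eulerOp_gradedMul (z : ℝ) (f g : ℕ → ℝ⟦X⟧) (N : ℕ) :
    eulerOp (gradedMul z f g N) = gradedMul z (fun i => eulerOp (f i)) g N +
      gradedMul z f (fun i => eulerOp (g i)) N := by
  simp only [gradedMul, map_sum, ← Finset.sum_add_distrib, Derivation.map_smul, Derivation.leibniz,
    smul_eq_mul]
  refine Finset.sum_congr rfl fun p _ => ?_
  rw [← smul_add]
  ring_nf

theorem gradedMul_shift_left (z : ℝ) {f h : ℕ → ℝ⟦X⟧} (g : ℕ → ℝ⟦X⟧) (N : ℕ) (h₀ : h 0 = 0)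
    (hs : ∀ i, h (i + 1) = f i) : gradedMul z h g (N + 1) = z • gradedMul z f g N := by
  simp only [gradedMul, Finset.Nat.sum_antidiagonal_succ, h₀, hs, Finset.smul_sum, smul_smul,
    pow_succ']
  simp

theorem gradedMul_shift_right (z : ℝ) (f : ℕ → ℝ⟦X⟧) {g h : ℕ → ℝ⟦X⟧} (N : ℕ) (h₀ : h 0 = 0)
    (hs : ∀ i, h (i + 1) = g i) : gradedMul z f h (N + 1) = gradedMul z f g N := by
  simp only [gradedMul, Finset.Nat.sum_antidiagonal_succ', h₀, hs]
  simp

theorem gradedMul_mul_left (z : ℝ) (a : ℝ⟦X⟧) (f g : ℕ → ℝ⟦X⟧) (N : ℕ) :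
    gradedMul z (fun i => a * f i) g N = a * gradedMul z f g N := by
  simp only [gradedMul, Finset.mul_sum, mul_smul_comm, mul_assoc]

theorem gradedMul_mul_right (z : ℝ) (a : ℝ⟦X⟧) (f g : ℕ → ℝ⟦X⟧) (N : ℕ) :
    gradedMul z f (fun i => a * g i) N = a * gradedMul z f g N := by
  simp only [gradedMul, Finset.mul_sum, mul_smul_comm, mul_left_comm]

/-- The polylogarithm of index `{2}^i`. -/
noncomputable def polylogTwos (i : ℕ) : ℝ⟦X⟧ := polylog (List.replicate i 2)

/-- The polylogarithm of index `{2}^i, 1`. -/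
noncomputable def polylogTwosOne (i : ℕ) : ℝ⟦X⟧ := polylog (1 :: List.replicate i 2)

theorem eulerOp_polylogTwos_zero : eulerOp (polylogTwos 0) = 0 := by
  simp [polylogTwos, polylog_nil]

theorem eulerOp_polylogTwos_succ (i : ℕ) : eulerOp (polylogTwos (i + 1)) = polylogTwosOne i := by
  rw [polylogTwos, List.replicate_succ, eulerOp_polylog_succ_cons 1, polylogTwosOne]

theorem eulerOp_polylogTwosOne (i : ℕ) :
    eulerOp (polylogTwosOne i) = geomTail * polylogTwos i := by
  rw [polylogTwosOne, eulerOp_polylog_one_cons, polylogTwos]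

theorem constantCoeff_polylogTwosOne (i : ℕ) : constantCoeff (polylogTwosOne i) = 0 :=
  constantCoeff_polylog_cons _ _

theorem constantCoeff_polylogTwos_succ (i : ℕ) : constantCoeff (polylogTwos (i + 1)) = 0 :=
  constantCoeff_polylog_cons _ _

local notation "𝓕" => polylogTwos
local notation "𝓖" => polylogTwosOne

theorem eulerOp_gradedMul_twos_twos (z : ℝ) (N : ℕ) :
    eulerOp (gradedMul z 𝓕 𝓕 (N + 1)) = z • gradedMul z 𝓖 𝓕 N + gradedMul z 𝓕 𝓖 N := by
  rw [eulerOp_gradedMul, gradedMul_shift_left z _ N eulerOp_polylogTwos_zero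
    eulerOp_polylogTwos_succ, gradedMul_shift_right z _ N eulerOp_polylogTwos_zero
    eulerOp_polylogTwos_succ]

theorem eulerOp_gradedMul_twosOne_twos_zero (z : ℝ) :
    eulerOp (gradedMul z 𝓖 𝓕 0) = geomTail * gradedMul z 𝓕 𝓕 0 := by
  simp only [eulerOp_gradedMul, eulerOp_polylogTwosOne, gradedMul_mul_left]
  simp [gradedMul, eulerOp_polylogTwos_zero]

theorem eulerOp_gradedMul_twos_twosOne_zero (z : ℝ) :
    eulerOp (gradedMul z 𝓕 𝓖 0) = geomTail * gradedMul z 𝓕 𝓕 0 := by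
  simp only [eulerOp_gradedMul, eulerOp_polylogTwosOne, gradedMul_mul_right]
  simp [gradedMul, eulerOp_polylogTwos_zero]

theorem eulerOp_gradedMul_twosOne_twos (z : ℝ) (N : ℕ) :
    eulerOp (gradedMul z 𝓖 𝓕 (N + 1)) =
      geomTail * gradedMul z 𝓕 𝓕 (N + 1) + gradedMul z 𝓖 𝓖 N := by
  rw [eulerOp_gradedMul, gradedMul_shift_right z 𝓖 N eulerOp_polylogTwos_zero
    eulerOp_polylogTwos_succ]
  simp only [eulerOp_polylogTwosOne, gradedMul_mul_left]

theorem eulerOp_gradedMul_twos_twosOne (z : ℝ) (N : ℕ) :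
    eulerOp (gradedMul z 𝓕 𝓖 (N + 1)) =
      geomTail * gradedMul z 𝓕 𝓕 (N + 1) + z • gradedMul z 𝓖 𝓖 N := by
  rw [eulerOp_gradedMul, gradedMul_shift_left z 𝓖 N eulerOp_polylogTwos_zero
    eulerOp_polylogTwos_succ, add_comm]
  simp only [eulerOp_polylogTwosOne, gradedMul_mul_right]

theorem eulerOp_gradedMul_twosOne_twosOne (z : ℝ) (N : ℕ) :
    eulerOp (gradedMul z 𝓖 𝓖 N) = geomTail * (gradedMul z 𝓖 𝓕 N + gradedMul z 𝓕 𝓖 N) := by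
  rw [eulerOp_gradedMul]
  simp only [eulerOp_polylogTwosOne, gradedMul_mul_right, gradedMul_mul_left]
  rw [mul_add, add_comm]

theorem constantCoeff_gradedMul_twosOne_left (z : ℝ) (f : ℕ → ℝ⟦X⟧) (N : ℕ) :
    constantCoeff (gradedMul z 𝓖 f N) = 0 := by
  simp [gradedMul, constantCoeff_polylogTwosOne]

theorem constantCoeff_gradedMul_twosOne_right (z : ℝ) (f : ℕ → ℝ⟦X⟧) (N : ℕ) :
    constantCoeff (gradedMul z f 𝓖 N) = 0 := by
  simp [gradedMul, constantCoeff_polylogTwosOne]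

theorem constantCoeff_gradedMul_twos_succ (z : ℝ) (N : ℕ) :
    constantCoeff (gradedMul z 𝓕 𝓕 (N + 1)) = 0 := by
  rw [gradedMul, Finset.Nat.sum_antidiagonal_succ, map_add, map_sum]
  simp [constantCoeff_polylogTwos_succ]

end Convolution

theorem map_wordSum {M M' : Type*} [AddCommMonoid M] [AddCommMonoid M'] (φ : M →+ M') (c k m : ℕ)
    (a : ℕ → ℕ) (Φ : List ℕ → M) :
    φ (wordSum c k m a Φ) = wordSum c k m a fun w => φ (Φ w) := by
  induction k generalizing m a Φ with
  | zero => simp only [wordSum_zero_left]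
  | succ k ihk =>
    induction m generalizing Φ with
    | zero => simp only [wordSum_succ_zero, ihk]
    | succ m ihm => simp only [wordSum_succ_succ, map_add, ihk, ihm]

section BowmanBradleySeries

open PowerSeries

/-- The sum of the polylogarithms of index `w, p` where `w` runs through the shuffles of `{2}^m`
with the first `k` terms of `1, 3, 1, 3, …`; the index `p` is given in reverse order. -/
noncomputable def bbSum (p : List ℕ) (k m : ℕ) : ℝ⟦X⟧ :=
  wordSum 2 k m (alternating 1 3) fun w => polylog (p ++ w.reverse)

theorem eulerOp_bbSum_one (k m : ℕ) : eulerOp (bbSum [1] k m) = geomTail * bbSum [] k m := by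
  have h₁ := map_wordSum (eulerOp : ℝ⟦X⟧ →ₗ[ℝ] ℝ⟦X⟧).toAddMonoidHom 2 k m (alternating 1 3)
    fun w => polylog ([1] ++ w.reverse)
  have h₂ := map_wordSum (AddMonoidHom.mulLeft geomTail) 2 k m (alternating 1 3)
    fun w => polylog w.reverse
  refine h₁.trans (Eq.trans ?_ h₂.symm)
  congr 1
  ext1 w
  exact eulerOp_polylog_one_cons _

theorem eulerOp_bbSum_succ (j k m : ℕ) :
    eulerOp (bbSum [j + 1] k m) = bbSum [j] k m := by
  have h₁ := map_wordSum (eulerOp : ℝ⟦X⟧ →ₗ[ℝ] ℝ⟦X⟧).toAddMonoidHom 2 k m (alternating 1 3)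
    fun w => polylog ([j + 1] ++ w.reverse)
  refine h₁.trans ?_
  rw [bbSum]
  congr 1
  ext1 w
  exact eulerOp_polylog_succ_cons j _

theorem constantCoeff_bbSum_cons (j : ℕ) (p : List ℕ) (k m : ℕ) :
    constantCoeff (bbSum (j :: p) k m) = 0 := by
  have h₁ := map_wordSum (constantCoeff : ℝ⟦X⟧ →+* ℝ).toAddMonoidHom 2 k m (alternating 1 3)
    fun w => polylog ((j :: p) ++ w.reverse)
  have h₂ := map_wordSum (0 : ℝ⟦X⟧ →+ ℝ) 2 k m (alternating 1 3) fun w => polylog w.reverse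
  refine h₁.trans (Eq.trans ?_ h₂.symm)
  congr 1
  ext1 w
  exact constantCoeff_polylog_cons _ _

theorem bbSum_nil_zero_zero : bbSum [] 0 0 = 1 := by
  simp [bbSum, wordSum, polylog_nil]

theorem bbSum_nil_zero_succ (m : ℕ) : bbSum [] 0 (m + 1) = bbSum [2] 0 m := by
  rw [bbSum, wordSum_zero_succ_append]
  simp [bbSum]

theorem bbSum_nil_succ_zero (k : ℕ) :
    bbSum [] (k + 1) 0 = bbSum [alternating 1 3 k] k 0 := by
  rw [bbSum, wordSum_succ_zero_append]
  simp [bbSum]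

theorem bbSum_nil_succ_succ (k m : ℕ) :
    bbSum [] (k + 1) (m + 1) = bbSum [2] (k + 1) m + bbSum [alternating 1 3 k] k (m + 1) := by
  rw [bbSum, wordSum_succ_succ_append]
  simp [bbSum]

theorem alternating_two_mul (a b l : ℕ) : alternating a b (2 * l) = a := by
  simp [alternating]

theorem alternating_two_mul_add_one (a b l : ℕ) : alternating a b (2 * l + 1) = b := by
  rw [alternating_succ, alternating_two_mul]

/-- The series of the indices with `l` ones, `l` threes and `N - 2 * l` twos (zero if
`N < 2 * l`). -/
noncomputable def evenSeries (l N : ℕ) : ℝ⟦X⟧ :=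
  if 2 * l ≤ N then bbSum [] (2 * l) (N - 2 * l) else 0

/-- The series of the indices with `l + 1` ones, `l` threes and `N - 2 * l` twos. -/
noncomputable def oddSeries (l N : ℕ) : ℝ⟦X⟧ :=
  if 2 * l ≤ N then bbSum [] (2 * l + 1) (N - 2 * l) else 0

/-- The series of the indices occurring in `oddSeries`, followed by `1`. -/
noncomputable def oddSeriesOne (l N : ℕ) : ℝ⟦X⟧ :=
  if 2 * l ≤ N then bbSum [1] (2 * l + 1) (N - 2 * l) else 0

theorem evenSeries_of_lt {l N : ℕ} (h : N < 2 * l) : evenSeries l N = 0 := by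
  rw [evenSeries, if_neg (by omega)]

theorem oddSeries_of_lt {l N : ℕ} (h : N < 2 * l) : oddSeries l N = 0 := by
  rw [oddSeries, if_neg (by omega)]

theorem oddSeriesOne_of_lt {l N : ℕ} (h : N < 2 * l) : oddSeriesOne l N = 0 := by
  rw [oddSeriesOne, if_neg (by omega)]

theorem eulerOp_oddSeriesOne (l N : ℕ) :
    eulerOp (oddSeriesOne l N) = geomTail * oddSeries l N := by
  rw [oddSeriesOne, oddSeries]
  split_ifs
  · exact eulerOp_bbSum_one _ _
  · simp

theorem eulerOp_oddSeries_zero (l : ℕ) :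
    eulerOp (oddSeries l 0) = geomTail * evenSeries l 0 := by
  rw [oddSeries, evenSeries]
  split_ifs
  · rw [Nat.zero_sub, bbSum_nil_succ_zero, alternating_two_mul, eulerOp_bbSum_one]
  · simp

theorem eulerOp_oddSeries_succ (l N : ℕ) :
    eulerOp (oddSeries l (N + 1)) = geomTail * evenSeries l (N + 1) + oddSeriesOne l N := by
  rcases lt_trichotomy (N + 1) (2 * l) with h | h | h
  · rw [oddSeries_of_lt h, evenSeries_of_lt h, oddSeriesOne_of_lt (by omega)]
    simp
  · rw [oddSeriesOne_of_lt (by omega), oddSeries, evenSeries, if_pos h.ge, if_pos h.ge, h,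
      Nat.sub_self, bbSum_nil_succ_zero, alternating_two_mul, eulerOp_bbSum_one, add_zero]
  · obtain ⟨m, rfl⟩ := Nat.exists_eq_add_of_le (Nat.lt_succ_iff.1 h)
    rw [oddSeriesOne, oddSeries, evenSeries, if_pos (by omega), if_pos (by omega),
      if_pos (by omega), show 2 * l + m + 1 - 2 * l = m + 1 by omega, Nat.add_sub_cancel_left,
      bbSum_nil_succ_succ, alternating_two_mul, map_add, eulerOp_bbSum_one,
      eulerOp_bbSum_succ 1, add_comm]

theorem eulerOp_evenSeries_zero_succ (N : ℕ) :
    eulerOp (eulerOp (evenSeries 0 (N + 1))) = geomTail * evenSeries 0 N := by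
  simp only [evenSeries, mul_zero, zero_le, if_true, Nat.sub_zero]
  rw [bbSum_nil_zero_succ, eulerOp_bbSum_succ 1, eulerOp_bbSum_one]

theorem eulerOp_evenSeries_succ_succ (l N : ℕ) :
    eulerOp (eulerOp (evenSeries (l + 1) (N + 2))) =
      geomTail * evenSeries (l + 1) (N + 1) + oddSeriesOne l N := by
  rcases lt_trichotomy (N + 2) (2 * (l + 1)) with h | h | h
  · rw [evenSeries_of_lt h, evenSeries_of_lt (by omega), oddSeriesOne_of_lt (by omega)]
    simp
  · obtain rfl : N = 2 * l := by omega
    rw [evenSeries_of_lt (l := l + 1) (N := 2 * l + 1) (by omega), oddSeriesOne, evenSeries,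
      if_pos h.ge, if_pos le_rfl,
      ← h, Nat.sub_self, Nat.sub_self, bbSum_nil_succ_zero, alternating_two_mul_add_one,
      eulerOp_bbSum_succ 2, eulerOp_bbSum_succ 1]
    simp
  · obtain ⟨m, hm⟩ := Nat.exists_eq_add_of_le h
    obtain rfl : N = 2 * l + (m + 1) := by omega
    rw [oddSeriesOne, evenSeries, evenSeries, if_pos (by omega), if_pos (by omega),
      if_pos (by omega), show 2 * l + (m + 1) + 2 - 2 * (l + 1) = m + 1 by omega,
      show 2 * l + (m + 1) + 1 - 2 * (l + 1) = m by omega, Nat.add_sub_cancel_left,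
      show 2 * (l + 1) = 2 * l + 1 + 1 by ring,
      bbSum_nil_succ_succ, alternating_two_mul_add_one, map_add, map_add,
      eulerOp_bbSum_succ 1, eulerOp_bbSum_succ 2,
      eulerOp_bbSum_succ 1, eulerOp_bbSum_one]

theorem constantCoeff_oddSeriesOne (l N : ℕ) : constantCoeff (oddSeriesOne l N) = 0 := by
  rw [oddSeriesOne]
  split_ifs
  · exact constantCoeff_bbSum_cons _ _ _ _
  · simp

theorem constantCoeff_bbSum_nil (k m : ℕ) (h : k + m ≠ 0) :
    constantCoeff (bbSum [] k m) = 0 := by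
  cases k with
  | zero =>
    obtain ⟨m, rfl⟩ := Nat.exists_eq_succ_of_ne_zero (by omega : m ≠ 0)
    rw [bbSum_nil_zero_succ, constantCoeff_bbSum_cons]
  | succ k =>
    cases m with
    | zero => rw [bbSum_nil_succ_zero, constantCoeff_bbSum_cons]
    | succ m =>
      rw [bbSum_nil_succ_succ, map_add, constantCoeff_bbSum_cons, constantCoeff_bbSum_cons,
        add_zero]

theorem constantCoeff_oddSeries (l N : ℕ) : constantCoeff (oddSeries l N) = 0 := by
  rw [oddSeries]
  split_ifs
  · exact constantCoeff_bbSum_nil _ _ (by omega)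
  · simp

theorem constantCoeff_evenSeries_succ (l N : ℕ) : constantCoeff (evenSeries l (N + 1)) = 0 := by
  rw [evenSeries]
  split_ifs
  · exact constantCoeff_bbSum_nil _ _ (by omega)
  · simp

/-- The generating polynomial `∑ s ^ l • f l N` of a family vanishing for `N < 2 * l`. -/
noncomputable def genSum (s : ℝ) (f : ℕ → ℕ → ℝ⟦X⟧) (N : ℕ) : ℝ⟦X⟧ :=
  ∑ l ∈ Finset.range (N + 1), s ^ l • f l N

theorem genSum_eq_sum_range (s : ℝ) {f : ℕ → ℕ → ℝ⟦X⟧} {N K : ℕ} (hK : N + 1 ≤ K)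
    (hf : ∀ l, N < 2 * l → f l N = 0) :
    genSum s f N = ∑ l ∈ Finset.range K, s ^ l • f l N := by
  refine Finset.sum_subset (Finset.range_subset_range.2 hK) fun l _ hl => ?_
  rw [hf l (by rw [Finset.mem_range] at hl; omega), smul_zero]

theorem eulerOp_genSum_oddSeriesOne (s : ℝ) (N : ℕ) :
    eulerOp (genSum s oddSeriesOne N) = geomTail * genSum s oddSeries N := by
  simp only [genSum, map_sum, Derivation.map_smul, eulerOp_oddSeriesOne, Finset.mul_sum,
    mul_smul_comm]

theorem eulerOp_genSum_oddSeries_zero (s : ℝ) :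
    eulerOp (genSum s oddSeries 0) = geomTail * genSum s evenSeries 0 := by
  simp only [genSum, map_sum, Derivation.map_smul, eulerOp_oddSeries_zero, Finset.mul_sum,
    mul_smul_comm]

theorem eulerOp_genSum_oddSeries_succ (s : ℝ) (N : ℕ) :
    eulerOp (genSum s oddSeries (N + 1)) =
      geomTail * genSum s evenSeries (N + 1) + genSum s oddSeriesOne N := by
  rw [genSum_eq_sum_range s (K := N + 1 + 1) (by omega) fun l => oddSeriesOne_of_lt]
  simp only [genSum, map_sum, Derivation.map_smul, eulerOp_oddSeries_succ, Finset.mul_sum,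
    mul_smul_comm, smul_add, Finset.sum_add_distrib]

theorem eulerOp_genSum_evenSeries_one (s : ℝ) :
    eulerOp (eulerOp (genSum s evenSeries 1)) = geomTail * genSum s evenSeries 0 := by
  rw [genSum, Finset.sum_range_succ, evenSeries_of_lt (by omega : 1 < 2 * 1)]
  simp [genSum, eulerOp_evenSeries_zero_succ]

theorem eulerOp_genSum_evenSeries_succ_succ (s : ℝ) (N : ℕ) :
    eulerOp (eulerOp (genSum s evenSeries (N + 2))) =
      geomTail * genSum s evenSeries (N + 1) + s • genSum s oddSeriesOne N := by
  rw [genSum_eq_sum_range s (N := N + 1) (K := N + 2 + 1) (by omega) fun l => evenSeries_of_lt,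
    genSum_eq_sum_range s (N := N) (K := N + 2) (by omega) fun l => oddSeriesOne_of_lt]
  simp only [genSum, map_sum, map_add, Derivation.map_smul, Finset.sum_range_succ' _ (N + 2),
    eulerOp_evenSeries_succ_succ, eulerOp_evenSeries_zero_succ, Finset.mul_sum, mul_add,
    mul_smul_comm, smul_add, Finset.sum_add_distrib, Finset.smul_sum, smul_smul, pow_succ']
  abel

theorem constantCoeff_genSum {s : ℝ} {f : ℕ → ℕ → ℝ⟦X⟧} {N : ℕ}
    (hf : ∀ l, constantCoeff (f l N) = 0) : constantCoeff (genSum s f N) = 0 := by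
  simp [genSum, hf]

theorem genSum_eq_gradedMul {z : ℝ} (hz : 1 + z ≠ 0) (N : ℕ) :
    (1 + z) ^ N • genSum (4 * z / (1 + z) ^ 2) evenSeries N =
        gradedMul z polylogTwos polylogTwos N ∧
      (2 * (1 + z) ^ N) • genSum (4 * z / (1 + z) ^ 2) oddSeries N =
        gradedMul z polylogTwosOne polylogTwos N + gradedMul z polylogTwos polylogTwosOne N ∧
      (2 * (1 + z) ^ N) • genSum (4 * z / (1 + z) ^ 2) oddSeriesOne N =
        gradedMul z polylogTwosOne polylogTwosOne N := by
  set s := 4 * z / (1 + z) ^ 2 with hs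
  have one_of_odd : ∀ N, (2 * (1 + z) ^ N) • genSum s oddSeries N =
        gradedMul z polylogTwosOne polylogTwos N + gradedMul z polylogTwos polylogTwosOne N →
      (2 * (1 + z) ^ N) • genSum s oddSeriesOne N =
        gradedMul z polylogTwosOne polylogTwosOne N := by
    intro N h
    apply eq_of_eulerOp_eq
    · rw [Derivation.map_smul, eulerOp_genSum_oddSeriesOne, eulerOp_gradedMul_twosOne_twosOne, ← h,
        mul_smul_comm]
    · rw [constantCoeff_gradedMul_twosOne_left, constantCoeff_smul,
        constantCoeff_genSum fun l => constantCoeff_oddSeriesOne l N, smul_zero]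
  have const_odd : ∀ N, constantCoeff ((2 * (1 + z) ^ N) • genSum s oddSeries N) =
      constantCoeff (gradedMul z polylogTwosOne polylogTwos N +
        gradedMul z polylogTwos polylogTwosOne N) := by
    intro N
    rw [map_add, constantCoeff_gradedMul_twosOne_left, constantCoeff_gradedMul_twosOne_right,
      constantCoeff_smul, constantCoeff_genSum fun l => constantCoeff_oddSeries l N]
    simp
  have even_of : ∀ N, eulerOp (eulerOp ((1 + z) ^ (N + 1) • genSum s evenSeries (N + 1))) =
        eulerOp (eulerOp (gradedMul z polylogTwos polylogTwos (N + 1))) →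
      (1 + z) ^ (N + 1) • genSum s evenSeries (N + 1) =
        gradedMul z polylogTwos polylogTwos (N + 1) := by
    intro N h
    refine eq_of_eulerOp_eq (eq_of_eulerOp_eq h ?_) ?_
    · rw [← coeff_zero_eq_constantCoeff_apply, ← coeff_zero_eq_constantCoeff_apply, coeff_eulerOp,
        coeff_eulerOp]
      simp
    · rw [constantCoeff_gradedMul_twos_succ, constantCoeff_smul,
        constantCoeff_genSum fun l => constantCoeff_evenSeries_succ l N, smul_zero]
  have even_zero : genSum s evenSeries 0 = gradedMul z polylogTwos polylogTwos 0 := by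
    simp [genSum, evenSeries, gradedMul, polylogTwos, polylog_nil, bbSum_nil_zero_zero]
  induction N using Nat.strong_induction_on with | _ N ih =>
  cases N with
  | zero =>
    have odd_zero : (2 * (1 + z) ^ 0) • genSum s oddSeries 0 =
        gradedMul z polylogTwosOne polylogTwos 0 + gradedMul z polylogTwos polylogTwosOne 0 := by
      refine eq_of_eulerOp_eq ?_ (const_odd 0)
      rw [Derivation.map_smul, eulerOp_genSum_oddSeries_zero, map_add,
        eulerOp_gradedMul_twosOne_twos_zero, eulerOp_gradedMul_twos_twosOne_zero, even_zero]
      simp [two_smul]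
    exact ⟨by simpa using even_zero, odd_zero, one_of_odd 0 odd_zero⟩
  | succ N =>
    obtain ⟨ih₁, -, ih₃⟩ := ih N (Nat.lt_succ_self N)
    have even_succ : (1 + z) ^ (N + 1) • genSum s evenSeries (N + 1) =
        gradedMul z polylogTwos polylogTwos (N + 1) := by
      apply even_of
      rw [Derivation.map_smul, Derivation.map_smul, eulerOp_gradedMul_twos_twos, map_add,
        Derivation.map_smul]
      cases N with
      | zero =>
        rw [zero_add, eulerOp_genSum_evenSeries_one, eulerOp_gradedMul_twosOne_twos_zero,
          eulerOp_gradedMul_twos_twosOne_zero, even_zero]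
        module
      | succ N =>
        rw [eulerOp_genSum_evenSeries_succ_succ, eulerOp_gradedMul_twosOne_twos,
          eulerOp_gradedMul_twos_twosOne, ← ih₁, smul_add, smul_smul]
        have h : (1 + z) ^ (N + 1 + 1) * s = 2 * z * (2 * (1 + z) ^ N) := by
          rw [hs]
          field_simp
          ring
        rw [h, ← smul_smul, (ih N (by omega)).2.2]
        simp only [mul_smul_comm]
        module
    have odd_succ : (2 * (1 + z) ^ (N + 1)) • genSum s oddSeries (N + 1) =
        gradedMul z polylogTwosOne polylogTwos (N + 1) +
          gradedMul z polylogTwos polylogTwosOne (N + 1) := by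
      refine eq_of_eulerOp_eq ?_ (const_odd (N + 1))
      rw [Derivation.map_smul, eulerOp_genSum_oddSeries_succ, map_add,
        eulerOp_gradedMul_twosOne_twos, eulerOp_gradedMul_twos_twosOne, ← ih₃, ← even_succ]
      simp only [mul_smul_comm]
      module
    exact ⟨even_succ, odd_succ, one_of_odd _ odd_succ⟩

end BowmanBradleySeries

section ZetaTwos

open Filter Topology

/-- Partial sums of the multiple zeta value `ζ({2}^i)`. -/
noncomputable def zetaTwosPartial (i M : ℕ) : ℝ :=
  ∑ n ∈ Finset.range M, (polylogCoeff (List.replicate i 2) n : ℝ)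

theorem zetaTwosPartial_zero (M : ℕ) : zetaTwosPartial 0 (M + 1) = 1 := by
  simp [zetaTwosPartial, polylogCoeff, Finset.sum_range_succ']

theorem zetaTwosPartial_succ_succ (i M : ℕ) :
    zetaTwosPartial (i + 1) (M + 1) =
      zetaTwosPartial (i + 1) M + ((M : ℝ) ^ 2)⁻¹ * zetaTwosPartial i M := by
  simp only [zetaTwosPartial, Finset.sum_range_succ _ M, List.replicate_succ, polylogCoeff]
  push_cast
  rfl

theorem zetaTwosPartial_one_succ (i : ℕ) : zetaTwosPartial (i + 1) 1 = 0 := by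
  simp [zetaTwosPartial, polylogCoeff, List.replicate_succ]

theorem zetaTwosPartial_eq_zero {i M : ℕ} (h : M < i) : zetaTwosPartial i (M + 1) = 0 := by
  obtain ⟨i, rfl⟩ := Nat.exists_eq_succ_of_ne_zero (by omega : i ≠ 0)
  induction M generalizing i with
  | zero => exact zetaTwosPartial_one_succ i
  | succ M ih =>
    obtain ⟨i, rfl⟩ := Nat.exists_eq_succ_of_ne_zero (by omega : i ≠ 0)
    rw [Nat.succ_eq_add_one, zetaTwosPartial_succ_succ, ih (i + 1) (by omega), ih i (by omega)]
    simp

theorem prod_one_add_div_sq (y : ℝ) (M : ℕ) :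
    ∏ j ∈ Finset.range M, (1 + y / ((j : ℝ) + 1) ^ 2) =
      ∑ i ∈ Finset.range (M + 1), y ^ i * zetaTwosPartial i (M + 1) := by
  induction M with
  | zero => simp [zetaTwosPartial_zero]
  | succ M ih =>
    have h : ∑ i ∈ Finset.range (M + 1), y ^ i * zetaTwosPartial i (M + 1) =
        ∑ i ∈ Finset.range (M + 1), y ^ (i + 1) * zetaTwosPartial (i + 1) (M + 1) + 1 := by
      rw [← add_zero (∑ i ∈ Finset.range (M + 1), y ^ i * zetaTwosPartial i (M + 1)),
        ← mul_zero (y ^ (M + 1)), ← zetaTwosPartial_eq_zero (Nat.lt_succ_self M),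
        ← Finset.sum_range_succ (fun i => y ^ i * zetaTwosPartial i (M + 1)),
        Finset.sum_range_succ', zetaTwosPartial_zero]
      simp
    have h' : ∑ i ∈ Finset.range (M + 1), y ^ (i + 1) * zetaTwosPartial (i + 1) (M + 1 + 1) =
        ∑ i ∈ Finset.range (M + 1), y ^ (i + 1) * zetaTwosPartial (i + 1) (M + 1) +
          y / ((M : ℝ) + 1) ^ 2 *
            ∑ i ∈ Finset.range (M + 1), y ^ i * zetaTwosPartial i (M + 1) := by
      rw [Finset.mul_sum, ← Finset.sum_add_distrib]
      refine Finset.sum_congr rfl fun i _ => ?_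
      rw [zetaTwosPartial_succ_succ]
      push_cast
      ring
    rw [Finset.prod_range_succ, ih, Finset.sum_range_succ' _ (M + 1), zetaTwosPartial_zero, h']
    linear_combination h

theorem zetaTwosPartial_nonneg (i M : ℕ) : 0 ≤ zetaTwosPartial i M :=
  Finset.sum_nonneg fun _ _ => NNReal.coe_nonneg _

theorem zetaTwosPartial_le (i M : ℕ) :
    zetaTwosPartial i M ≤ (∑' n : ℕ, ((n : ℝ) ^ 2)⁻¹) ^ i := by
  have hs : Summable fun n : ℕ => ((n : ℝ) ^ 2)⁻¹ := Real.summable_nat_pow_inv.2 one_lt_two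
  induction i generalizing M with
  | zero =>
    cases M with
    | zero => simp [zetaTwosPartial]
    | succ M => rw [zetaTwosPartial_zero, pow_zero]
  | succ i ih =>
    have h : zetaTwosPartial (i + 1) M =
        ∑ n ∈ Finset.range M, ((n : ℝ) ^ 2)⁻¹ * zetaTwosPartial i n := by
      simp only [zetaTwosPartial, List.replicate_succ, polylogCoeff]
      push_cast
      rfl
    rw [h, pow_succ']
    calc _ ≤ ∑ n ∈ Finset.range M, ((n : ℝ) ^ 2)⁻¹ * (∑' n : ℕ, ((n : ℝ) ^ 2)⁻¹) ^ i :=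
          Finset.sum_le_sum fun n _ => mul_le_mul_of_nonneg_left (ih n) (by positivity)
      _ ≤ _ := by
          rw [← Finset.sum_mul]
          exact mul_le_mul_of_nonneg_right (hs.sum_le_tsum _ fun n _ => by positivity)
            (pow_nonneg (tsum_nonneg fun n => by positivity) _)

theorem summable_polylogCoeff_twos (i : ℕ) :
    Summable fun n => (polylogCoeff (List.replicate i 2) n : ℝ) :=
  summable_of_sum_range_le (fun _ => NNReal.coe_nonneg _) (zetaTwosPartial_le i)

theorem eq_zero_of_tsum_mul_pow_eq_zero {d : ℕ → ℝ} {A K : ℝ} (hK : 0 < K)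
    (hd : ∀ i, |d i| ≤ A * K ^ i) (h : ∀ y, y < 0 → -K⁻¹ < y → ∑' i, d i * y ^ i = 0) (i : ℕ) :
    d i = 0 := by
  set p := FormalMultilinearSeries.ofScalars ℝ d with hp
  have hr : 0 < p.radius := by
    refine lt_of_lt_of_le ?_ (p.le_radius_of_bound A (r := Real.toNNReal K⁻¹) fun n => ?_)
    · exact ENNReal.coe_pos.2 (Real.toNNReal_pos.2 (inv_pos.2 hK))
    · rw [hp, FormalMultilinearSeries.ofScalars_norm, Real.coe_toNNReal _ (inv_pos.2 hK).le,
        Real.norm_eq_abs, inv_pow,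
        ← div_eq_mul_inv, div_le_iff₀ (by positivity)]
      exact hd n
  have hs := (p.hasFPowerSeriesOnBall hr).hasFPowerSeriesAt
  have hz : p = 0 := by
    rw [← hs.locally_zero_iff]
    refine hs.analyticAt.eventually_eq_zero_or_eventually_ne_zero.resolve_right fun hne => ?_
    have h₁ : ∀ᶠ y in 𝓝[<] (0 : ℝ), p.sum y ≠ 0 :=
      hne.filter_mono (nhdsWithin_mono _ fun y hy => ne_of_lt hy)
    have h₂ : ∀ᶠ y in 𝓝[<] (0 : ℝ), -K⁻¹ < y :=
      (eventually_gt_nhds (by simpa using hK)).filter_mono nhdsWithin_le_nhds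
    have h₃ : ∀ᶠ y in 𝓝[<] (0 : ℝ), y < 0 := self_mem_nhdsWithin
    obtain ⟨y, hy₁, hy₂, hy₃⟩ := (h₁.and (h₂.and h₃)).exists
    refine hy₁ (Eq.trans ?_ (h y hy₃ hy₂))
    exact FormalMultilinearSeries.ofScalars_sum_eq d y
  have := congrArg (fun q : FormalMultilinearSeries ℝ ℝ ℝ => q i fun _ => 1) hz
  simpa [hp, FormalMultilinearSeries.ofScalars_apply_eq] using this

theorem tsum_polylogCoeff_twos (i : ℕ) :
    ∑' n, (polylogCoeff (List.replicate i 2) n : ℝ) =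
      Real.pi ^ (2 * i) / (2 * i + 1).factorial := by
  set Z : ℕ → ℝ := fun i => ∑' n, (polylogCoeff (List.replicate i 2) n : ℝ) with hZ
  set C : ℝ := ∑' n : ℕ, ((n : ℝ) ^ 2)⁻¹ with hC
  have hC0 : 0 ≤ C := tsum_nonneg fun n => by positivity
  have hlim : ∀ i, Tendsto (fun M => zetaTwosPartial i (M + 1)) atTop (𝓝 (Z i)) := fun i =>
    (summable_polylogCoeff_twos i).hasSum.tendsto_sum_nat.comp (tendsto_add_atTop_nat 1)
  have hZ0 : ∀ i, 0 ≤ Z i := fun i => tsum_nonneg fun n => NNReal.coe_nonneg _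
  have hZle : ∀ i, Z i ≤ C ^ i := fun i =>
    le_of_tendsto' (hlim i) fun M => zetaTwosPartial_le i _
  have hpi := Real.pi_pos
  set K := C + Real.pi ^ 2 with hK
  have hK0 : 0 < K := by positivity
  refine sub_eq_zero.1 (eq_zero_of_tsum_mul_pow_eq_zero (A := 2) hK0
    (d := fun i => Z i - Real.pi ^ (2 * i) / (2 * i + 1).factorial) (fun i => ?_)
    (fun y hy hy' => ?_) i)
  · have h₁ : Z i ≤ K ^ i := (hZle i).trans (pow_le_pow_left₀ hC0 (by rw [hK]; nlinarith) i)
    have h₂ : Real.pi ^ (2 * i) / (2 * i + 1).factorial ≤ K ^ i := by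
      refine (div_le_self (by positivity) (by exact_mod_cast Nat.factorial_pos _)).trans ?_
      rw [pow_mul]
      exact pow_le_pow_left₀ (by positivity) (by rw [hK]; linarith) i
    have h₃ : 0 ≤ Real.pi ^ (2 * i) / (2 * i + 1).factorial := by positivity
    rw [abs_le]
    constructor <;> linarith [hZ0 i]
  · have hyK : |y| * K < 1 := by
      rw [abs_of_neg hy, ← lt_div_iff₀ hK0, one_div]
      linarith
    have hyC : |y| * C < 1 :=
      (mul_le_mul_of_nonneg_left (by rw [hK]; nlinarith) (abs_nonneg y)).trans_lt hyK
    have hgeo : Summable fun i => (|y| * C) ^ i :=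
      summable_geometric_of_lt_one (by positivity) hyC
    have hT : Tendsto (fun M => ∑' i, y ^ i * zetaTwosPartial i (M + 1)) atTop
        (𝓝 (∑' i, y ^ i * Z i)) := by
      refine tendsto_tsum_of_dominated_convergence hgeo (fun i => (hlim i).const_mul _)
        (Eventually.of_forall fun M i => ?_)
      rw [norm_mul, norm_pow, Real.norm_eq_abs, Real.norm_eq_abs,
        abs_of_nonneg (zetaTwosPartial_nonneg _ _), mul_pow]
      exact mul_le_mul_of_nonneg_left (zetaTwosPartial_le _ _) (by positivity)
    set x := Real.sqrt (-y) with hx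
    have hx2 : x ^ 2 = -y := Real.sq_sqrt (by linarith)
    have hx0 : 0 < x := Real.sqrt_pos.2 (by linarith)
    have hprod : ∀ M, ∑' i, y ^ i * zetaTwosPartial i (M + 1) =
        ∏ j ∈ Finset.range M, (1 - x ^ 2 / ((j : ℝ) + 1) ^ 2) := by
      intro M
      rw [tsum_eq_sum (s := Finset.range (M + 1)), ← prod_one_add_div_sq]
      · refine Finset.prod_congr rfl fun j _ => ?_
        rw [hx2]
        ring
      · intro i hi
        rw [zetaTwosPartial_eq_zero (by simpa using hi), mul_zero]
    simp only [hprod] at hT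
    have h₁ := tendsto_nhds_unique (Real.tendsto_euler_sin_prod x) (hT.const_mul (Real.pi * x))
    have h₂ := (Real.hasSum_sin (Real.pi * x)).mul_left (Real.pi * x)⁻¹
    rw [h₁, inv_mul_cancel_left₀ (by positivity)] at h₂
    have hsZ : Summable fun i => y ^ i * Z i := by
      refine Summable.of_norm_bounded hgeo fun i => ?_
      rw [norm_mul, norm_pow, Real.norm_eq_abs, Real.norm_eq_abs, abs_of_nonneg (hZ0 i), mul_pow]
      exact mul_le_mul_of_nonneg_left (hZle i) (by positivity)
    have h₃ := hsZ.hasSum.sub h₂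
    rw [sub_self] at h₃
    rw [← h₃.tsum_eq]
    refine tsum_congr fun i => ?_
    have h₄ : y = -x ^ 2 := by linarith
    rw [sub_mul, mul_comm (y ^ i), h₄, neg_pow, ← pow_mul, mul_pow]
    field_simp
    ring

end ZetaTwos

section ClosedForm

open scoped Nat

theorem sum_range_two_mul_add_one_of_even_eq_zero {g : ℕ → ℝ} (hg : ∀ l, g (2 * l) = 0) (K : ℕ) :
    ∑ m ∈ Finset.range (2 * K + 1), g m = ∑ l ∈ Finset.range K, g (2 * l + 1) := by
  induction K with
  | zero => simpa using hg 0
  | succ K ih =>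
    rw [show 2 * (K + 1) + 1 = 2 * K + 1 + 1 + 1 by ring, Finset.sum_range_succ,
      Finset.sum_range_succ, ih, Finset.sum_range_succ, show 2 * K + 1 + 1 = 2 * (K + 1) by ring,
      hg, add_zero]

theorem add_pow_sub_sub_pow (a b : ℝ) {n K : ℕ} (h : n ≤ 2 * K) :
    (a + b) ^ n - (a - b) ^ n =
      2 * ∑ l ∈ Finset.range K, b ^ (2 * l + 1) * a ^ (n - (2 * l + 1)) * n.choose (2 * l + 1) := by
  have hs : ∀ c : ℝ, (a + c) ^ n =
      ∑ m ∈ Finset.range (2 * K + 1), c ^ m * a ^ (n - m) * n.choose m := by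
    intro c
    rw [add_comm, add_pow]
    refine Finset.sum_subset (Finset.range_subset_range.2 (by omega)) fun m _ hm => ?_
    rw [Nat.choose_eq_zero_of_lt (by simpa using hm), Nat.cast_zero, mul_zero]
  rw [sub_eq_add_neg a b, hs, hs, ← Finset.sum_sub_distrib,
    sum_range_two_mul_add_one_of_even_eq_zero (fun l => by simp [pow_mul]), Finset.mul_sum]
  refine Finset.sum_congr rfl fun l _ => ?_
  rw [Odd.neg_pow ⟨l, rfl⟩]
  ring

theorem sum_antidiagonal_inv_factorial (w : ℝ) (hw : w ≠ 0) (N : ℕ) :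
    ∑ p ∈ antidiagonal N, (w ^ 2) ^ p.1 * (1 / (2 * p.1 + 1)! * (1 / (2 * p.2 + 1)!)) =
      (1 + w ^ 2) ^ N * ∑ l ∈ Finset.range (N + 1), (4 * w ^ 2 / (1 + w ^ 2) ^ 2) ^ l *
        (N.choose (2 * l) / ((2 * l + 1) * (2 * N + 1)!)) := by
  have hz : 1 + w ^ 2 ≠ 0 := by positivity
  have h₁ := add_pow_sub_sub_pow 1 w (n := 2 * (N + 1)) le_rfl
  have h₂ := add_pow_sub_sub_pow (1 + w ^ 2) (2 * w) (n := N + 1) (K := N + 1) (by omega)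
  have h₃ : (1 + w) ^ (2 * (N + 1)) - (1 - w) ^ (2 * (N + 1)) =
      (1 + w ^ 2 + 2 * w) ^ (N + 1) - (1 + w ^ 2 - 2 * w) ^ (N + 1) := by
    rw [pow_mul, pow_mul]
    congr 2 <;> ring
  have hc : 2 * w * (2 * (N + 1))! ≠ 0 := by positivity
  refine mul_left_cancel₀ hc (Eq.trans ?_ ((h₁.symm.trans (h₃.trans h₂)).trans ?_))
  · rw [Finset.Nat.sum_antidiagonal_eq_sum_range_succ_mk, Finset.mul_sum, Finset.mul_sum]
    refine Finset.sum_congr rfl fun i hi => ?_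
    have hi' : i ≤ N := by simpa [Nat.lt_succ_iff] using hi
    rw [Nat.cast_choose ℝ (by omega : 2 * i + 1 ≤ 2 * (N + 1)),
      show 2 * (N + 1) - (2 * i + 1) = 2 * (N - i) + 1 by omega]
    field_simp
    ring
  · rw [Finset.mul_sum, Finset.mul_sum, Finset.mul_sum]
    refine Finset.sum_congr rfl fun l _ => ?_
    rcases lt_or_ge N (2 * l) with hl | hl
    · rw [Nat.choose_eq_zero_of_lt hl, Nat.choose_eq_zero_of_lt (by omega)]
      simp
    · have hch : (2 * (l : ℝ) + 1) * (N + 1).choose (2 * l + 1) = (N + 1) * N.choose (2 * l) := by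
        have := Nat.add_one_mul_choose_eq N (2 * l)
        have := congrArg (Nat.cast : ℕ → ℝ) this
        push_cast at this
        linarith
      have hch' : ((N + 1).choose (2 * l + 1) : ℝ) = (N + 1) * N.choose (2 * l) / (2 * l + 1) := by
        rw [eq_div_iff (by positivity)]
        linarith
      obtain ⟨d, hd⟩ := Nat.exists_eq_add_of_le hl
      rw [hch', show N + 1 - (2 * l + 1) = d by omega,
        show 2 * (N + 1) = 2 * N + 1 + 1 by ring, Nat.factorial_succ]
      subst hd
      push_cast
      rw [show 4 * w ^ 2 = (2 * w) ^ 2 by ring, div_pow, ← pow_mul, ← pow_mul]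
      field_simp
      ring

end ClosedForm

section BowmanBradley

open PowerSeries

theorem evenSeries_eq_sum (l m : ℕ) :
    evenSeries l (2 * l + m) =
      ∑ f ∈ Finset.Nat.antidiagonalTuple (2 * l + 1) m,
        polylog (gapIndex 1 3 2 (List.ofFn f)).reverse := by
  rw [sum_gapIndex_eq_wordSum 1 3 2 l m fun w => polylog w.reverse, evenSeries,
    if_pos (by omega), Nat.add_sub_cancel_left, bbSum]
  simp

theorem coeff_evenSeries_nonneg (l N n : ℕ) : 0 ≤ coeff n (evenSeries l N) := by
  rcases lt_or_ge N (2 * l) with h | h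
  · rw [evenSeries_of_lt h, map_zero]
  · obtain ⟨m, rfl⟩ := Nat.exists_eq_add_of_le h
    rw [evenSeries_eq_sum, map_sum]
    exact Finset.sum_nonneg fun f _ => by rw [coeff_polylog]; exact NNReal.coe_nonneg _

theorem hasSum_coeff_mul {f g : ℝ⟦X⟧} {a b : ℝ} (hf : HasSum (fun n => coeff n f) a)
    (hg : HasSum (fun n => coeff n g) b) : HasSum (fun n => coeff n (f * g)) (a * b) := by
  simp only [coeff_mul]
  have hf' := hf.summable.norm
  have hg' := hg.summable.norm
  rw [← hf.tsum_eq, ← hg.tsum_eq, tsum_mul_tsum_eq_tsum_sum_antidiagonal_of_summable_norm hf' hg']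
  exact (summable_norm_sum_mul_antidiagonal_of_summable_norm hf' hg').of_norm.hasSum

theorem hasSum_coeff_polylogTwos (i : ℕ) :
    HasSum (fun n => coeff n (polylogTwos i)) (Real.pi ^ (2 * i) / (2 * i + 1).factorial) := by
  simp only [polylogTwos, coeff_polylog]
  rw [← tsum_polylogCoeff_twos]
  exact (summable_polylogCoeff_twos i).hasSum

theorem hasSum_coeff_gradedMul_twos (z : ℝ) (N : ℕ) :
    HasSum (fun n => coeff n (gradedMul z polylogTwos polylogTwos N))
      (∑ p ∈ antidiagonal N, z ^ p.1 * (Real.pi ^ (2 * p.1) / (2 * p.1 + 1).factorial *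
        (Real.pi ^ (2 * p.2) / (2 * p.2 + 1).factorial))) := by
  simp only [gradedMul, map_sum, coeff_smul]
  exact hasSum_sum fun p _ =>
    (hasSum_coeff_mul (hasSum_coeff_polylogTwos _) (hasSum_coeff_polylogTwos _)).mul_left _

theorem hasSum_coeff_genSum {w : ℝ} (hw : w ≠ 0) (N : ℕ) :
    HasSum (fun n => coeff n (genSum (4 * w ^ 2 / (1 + w ^ 2) ^ 2) evenSeries N))
      (∑ l ∈ Finset.range (N + 1), (4 * w ^ 2 / (1 + w ^ 2) ^ 2) ^ l *
        (N.choose (2 * l) * Real.pi ^ (2 * N) / ((2 * l + 1) * (2 * N + 1).factorial))) := by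
  have hz : 1 + w ^ 2 ≠ 0 := by positivity
  have h := hasSum_coeff_gradedMul_twos (w ^ 2) N
  rw [← (genSum_eq_gradedMul hz N).1] at h
  simp only [coeff_smul, smul_eq_mul] at h
  have hz' : (1 + w ^ 2) ^ N ≠ 0 := by positivity
  rw [← hasSum_mul_left_iff hz']
  have hsum : (1 + w ^ 2) ^ N * ∑ l ∈ Finset.range (N + 1), (4 * w ^ 2 / (1 + w ^ 2) ^ 2) ^ l *
        (N.choose (2 * l) * Real.pi ^ (2 * N) / ((2 * l + 1) * (2 * N + 1).factorial)) =
      Real.pi ^ (2 * N) * ((1 + w ^ 2) ^ N *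
        ∑ l ∈ Finset.range (N + 1), (4 * w ^ 2 / (1 + w ^ 2) ^ 2) ^ l *
          (N.choose (2 * l) / ((2 * l + 1) * (2 * N + 1).factorial))) := by
    simp only [Finset.mul_sum]
    exact Finset.sum_congr rfl fun l _ => by ring
  rw [hsum, ← sum_antidiagonal_inv_factorial w hw, Finset.mul_sum]
  rw [Finset.sum_congr rfl fun p hp => ?_]
  · exact h
  · rw [← Finset.HasAntidiagonal.mem_antidiagonal.1 hp]
    ring

theorem summable_coeff_evenSeries (l N : ℕ) : Summable fun n => coeff n (evenSeries l N) := by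
  rcases lt_or_ge N l with h | h
  · simp [evenSeries_of_lt (by omega : N < 2 * l), summable_zero]
  · have hs := (hasSum_coeff_genSum one_ne_zero N).summable
    norm_num at hs
    refine Summable.of_nonneg_of_le (coeff_evenSeries_nonneg l N) (fun n => ?_) hs
    simp only [genSum, one_pow, one_smul, map_sum]
    exact Finset.single_le_sum (f := fun l => coeff n (evenSeries l N))
      (fun i _ => coeff_evenSeries_nonneg i N n) (Finset.mem_range.2 (by omega))

theorem tsum_coeff_evenSeries (l N : ℕ) (hl : l ≤ N) :
    ∑' n, coeff n (evenSeries l N) =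
      N.choose (2 * l) * Real.pi ^ (2 * N) / ((2 * l + 1) * (2 * N + 1).factorial) := by
  set P : Polynomial ℝ := ∑ l ∈ Finset.range (N + 1),
    Polynomial.monomial l (∑' n, coeff n (evenSeries l N)) with hP
  set Q : Polynomial ℝ := ∑ l ∈ Finset.range (N + 1), Polynomial.monomial l
    ((N.choose (2 * l) * Real.pi ^ (2 * N) / ((2 * l + 1) * (2 * N + 1).factorial) : ℝ)) with hQ
  have hPQ : P = Q := by
    refine Polynomial.eq_of_infinite_eval_eq P Q (Set.Infinite.mono ?_
      ((Set.Ioo_infinite (zero_lt_one' ℝ)).image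
        (f := fun w : ℝ => 4 * w ^ 2 / (1 + w ^ 2) ^ 2) ?_))
    · rintro _ ⟨w, hw, rfl⟩
      have h := hasSum_coeff_genSum hw.1.ne' N
      simp only [genSum, map_sum, coeff_smul] at h
      have h' := hasSum_sum fun l (_ : l ∈ Finset.range (N + 1)) =>
        (summable_coeff_evenSeries l N).hasSum.mul_left ((4 * w ^ 2 / (1 + w ^ 2) ^ 2) ^ l)
      have h'' := h'.unique h
      simp only [Set.mem_ofPred_eq, hP, hQ, Polynomial.eval_finsetSum, Polynomial.eval_monomial]
      simpa only [mul_comm] using h''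
    · intro u hu v hv huv
      have hu2 : 0 < 1 - u * v := by nlinarith [hu.1, hu.2, hv.1, hv.2]
      have h0 : (2 * u / (1 + u ^ 2)) ^ 2 = (2 * v / (1 + v ^ 2)) ^ 2 := by
        simp only at huv
        rw [div_pow, div_pow, mul_pow, mul_pow]
        norm_num
        exact huv
      have hu0 := hu.1
      have hv0 := hv.1
      rw [sq_eq_sq₀ (by positivity) (by positivity), div_eq_div_iff (by positivity)
        (by positivity)] at h0
      have : (u - v) * (1 - u * v) = 0 := by linarith
      exact sub_eq_zero.1 ((mul_eq_zero.1 this).resolve_right hu2.ne')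
  have h := congrArg (fun p => Polynomial.coeff p l) hPQ
  simpa [hP, hQ, Polynomial.finsetSum_coeff, Polynomial.coeff_monomial, Nat.lt_succ_iff, hl]
    using h

theorem sum_mzv_gapIndex (l m : ℕ) :
    ∑ f ∈ Finset.Nat.antidiagonalTuple (2 * l + 1) m, mzv (gapIndex 1 3 2 (List.ofFn f)) =
      ∑' n, coeff n (evenSeries l (2 * l + m)) := by
  have hs := summable_coeff_evenSeries l (2 * l + m)
  simp only [evenSeries_eq_sum, map_sum, coeff_polylog] at hs ⊢
  simp only [mzv_eq_tsum_polylogCoeff]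
  refine (Summable.tsum_finsetSum fun f hf => ?_).symm
  refine Summable.of_nonneg_of_le (fun _ => NNReal.coe_nonneg _) (fun n => ?_) hs
  exact Finset.single_le_sum
    (f := fun f => (polylogCoeff (gapIndex 1 3 2 (List.ofFn f)).reverse n : ℝ))
    (fun _ _ => NNReal.coe_nonneg _) hf

end BowmanBradley

/-- Bowman–Bradley's theorem. -/
theorem stmt4 (l m : ℕ) :
    ∑ f ∈ Finset.Nat.antidiagonalTuple (2 * l + 1) m,
        mzv (gapIndex 1 3 2 (List.ofFn f))
      = ((2 * l + m).choose (2 * l) : ℝ) * Real.pi ^ (4 * l + 2 * m) /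
          ((2 * l + 1) * (4 * l + 2 * m + 1).factorial) := by
  rw [sum_mzv_gapIndex, tsum_coeff_evenSeries l _ (by omega),
    show 4 * l + 2 * m = 2 * (2 * l + m) by ring]
end

section
/- For every positive integer r, for all but finitely many primes p the following congruence of rational numbers holds modulo p²: Z_p({2}^r) = ∑_{1 ≤ n₁ < ⋯ < n_r ≤ p−1} 1/(n₁² ⋯ n_r²) is congruent to (−1)^{r−1} · 2 · (B_{p−2r−1}/(2r+1)) · p modulo p². -/
open Finset

theorem multiset_esymm_cons {R : Type*} [CommSemiring R] (x : R) (s : Multiset R) (k : ℕ) :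
    (x ::ₘ s).esymm (k + 1) = s.esymm (k + 1) + x * s.esymm k := by
  simp [Multiset.esymm, Multiset.powersetCard_cons, Multiset.map_map, Multiset.sum_map_mul_left]

theorem multiset_esymm_zero {R : Type*} [CommSemiring R] (s : Multiset R) : s.esymm 0 = 1 := by
  simp [Multiset.esymm]

theorem multiset_zero_esymm_succ {R : Type*} [CommSemiring R] (k : ℕ) :
    (0 : Multiset R).esymm (k + 1) = 0 := by
  simp [Multiset.esymm, Multiset.powersetCard_zero_right]

theorem ZAux_replicate_eq_esymm (N m : ℕ) : ∀ (d r a : ℕ), a + d = N + 1 →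
    ZAux N (List.replicate r m) a
      = ((Icc a N).val.map fun n : ℕ => ((n : ℚ) ^ m)⁻¹).esymm r := by
  intro d
  induction d with
  | zero =>
    intro r a ha
    have he : Icc a N = ∅ := Icc_eq_empty (by omega)
    cases r with
    | zero => simp [ZAux, multiset_esymm_zero]
    | succ r => simp [List.replicate_succ, ZAux, he, multiset_zero_esymm_succ]
  | succ d ih =>
    intro r a ha
    cases r with
    | zero => simp [ZAux, multiset_esymm_zero]
    | succ r =>
      have hi : Icc a N = cons a (Icc (a + 1) N) (by simp) := by
        ext x; simp only [mem_Icc, mem_cons]; omega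
      rw [hi, cons_val, Multiset.map_cons, multiset_esymm_cons, ← ih _ _ (by omega),
        ← ih _ _ (by omega)]
      simp only [List.replicate_succ, ZAux]
      rw [hi, sum_cons, add_comm]

/-- If all power sums of degree `1, …, r` are divisible by `d`, then the Newton identity for the `r`-th
elementary symmetric function reduces to its last term modulo `d ^ 2`. -/
theorem dvd_esymm_of_dvd_psum {σ R : Type*} [Fintype σ] [CommRing R] (f : σ → R) (d : R) (r : ℕ)
    (hu : ∀ i : ℕ, 0 < i → i ≤ r → IsUnit (i : R))
    (hp : ∀ i : ℕ, 0 < i → i ≤ r → d ∣ ∑ s, f s ^ i) (hr : 0 < r) :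
    d ^ 2 ∣ r * (univ.val.map f).esymm r - (-1) ^ (r - 1) * ∑ s, f s ^ r := by
  have key : ∀ k : ℕ, 0 < k → ∑ s, f s ^ k = (-1) ^ (k + 1) * k * (univ.val.map f).esymm k -
      ∑ a ∈ antidiagonal k with a.1 ∈ Set.Ioo 0 k,
        (-1) ^ a.1 * (univ.val.map f).esymm a.1 * ∑ s, f s ^ a.2 := by
    intro k hk
    have h := congrArg (MvPolynomial.aeval f) (MvPolynomial.psum_eq_mul_esymm_sub_sum σ R k hk)
    simpa [MvPolynomial.psum, ← MvPolynomial.aeval_esymm_eq_multiset_esymm σ R] using h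
  have hs : ∀ k : ℕ, (-1 : R) ^ (k + 1) * (-1) ^ (k + 1) = 1 := fun k => by
    rw [← mul_pow]; simp
  have he : ∀ k : ℕ, 0 < k → k ≤ r → d ∣ (univ.val.map f).esymm k := by
    intro k hk hkr
    have h1 : d ∣ (-1) ^ (k + 1) * k * (univ.val.map f).esymm k := by
      rw [← sub_add_cancel ((-1) ^ (k + 1) * k * (univ.val.map f).esymm k), ← key k hk]
      refine dvd_add (hp k hk hkr) (dvd_sum fun a ha => ?_)
      simp only [mem_filter, HasAntidiagonal.mem_antidiagonal, Set.mem_Ioo] at ha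
      exact Dvd.dvd.mul_left (hp _ (by omega) (by omega)) _
    have hunit : IsUnit ((-1 : R) ^ (k + 1) * k) :=
      (IsUnit.of_mul_eq_one _ (hs k)).mul (hu k hk hkr)
    exact hunit.dvd_mul_left.1 h1
  have h2 : d ^ 2 ∣ ∑ a ∈ antidiagonal r with a.1 ∈ Set.Ioo 0 r,
        (-1) ^ a.1 * (univ.val.map f).esymm a.1 * ∑ s, f s ^ a.2 := by
    refine dvd_sum fun a ha => ?_
    simp only [mem_filter, HasAntidiagonal.mem_antidiagonal, Set.mem_Ioo] at ha
    rw [sq]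
    exact mul_dvd_mul (Dvd.dvd.mul_left (he _ (by omega) (by omega)) _)
      (hp _ (by omega) (by omega))
  obtain ⟨k, rfl⟩ : ∃ k, r = k + 1 := ⟨r - 1, by omega⟩
  have h3 := key (k + 1) hr
  rw [Nat.add_sub_cancel, h3]
  convert h2.mul_left ((-1) ^ k) using 1
  have := hs (k + 1)
  linear_combination ((k + 1 : ℕ) : R) * (univ.val.map f).esymm (k + 1) * (- this)

theorem dvd_finset_esymm_of_dvd_sum_pow {ι R : Type*} [CommRing R] (s : Finset ι) (f : ι → R)
    (d : R) (r : ℕ) (hu : ∀ i : ℕ, 0 < i → i ≤ r → IsUnit (i : R))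
    (hp : ∀ i : ℕ, 0 < i → i ≤ r → d ∣ ∑ x ∈ s, f x ^ i) (hr : 0 < r) :
    d ^ 2 ∣ r * (s.val.map f).esymm r - (-1) ^ (r - 1) * ∑ x ∈ s, f x ^ r := by
  have h := dvd_esymm_of_dvd_psum (fun x : s => f x) d r hu
    (fun i h0 hi => by rw [sum_coe_sort s fun x => f x ^ i]; exact hp i h0 hi) hr
  rw [sum_coe_sort s fun x => f x ^ r] at h
  convert h using 4
  rw [univ_eq_attach, attach_val]
  exact (Multiset.attach_map_val' s.val f).symm

theorem multiset_esymm_map_ringHom {R S : Type*} [CommSemiring R] [CommSemiring S] (φ : R →+* S)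
    (s : Multiset R) (k : ℕ) : (s.map φ).esymm k = φ (s.esymm k) := by
  simp [Multiset.esymm, Multiset.powersetCard_map, map_multiset_sum, map_multiset_prod,
    Multiset.map_map]

theorem sum_range_even_sub_sum_range {R : Type*} [CommRing R] (h : ℕ → R) (q : ℕ) :
    ∑ i ∈ range (2 * q), h (2 * (i + 1)) - ∑ i ∈ range (2 * q), h (i + 1)
      = ∑ i ∈ range q, (h (2 * q + 1 + (2 * i + 1)) - h (2 * i + 1)) := by
  have h1 : ∀ q : ℕ, ∑ i ∈ range (2 * q), h (i + 1)
      = ∑ i ∈ range q, h (2 * (i + 1)) + ∑ i ∈ range q, h (2 * i + 1) := by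
    intro q
    induction q with
    | zero => simp
    | succ q ih =>
      rw [mul_add, mul_one, sum_range_succ, sum_range_succ, ih, sum_range_succ, sum_range_succ]
      ring_nf
  rw [h1, two_mul q, sum_range_add, sum_sub_distrib]
  have : ∀ i, 2 * (q + i + 1) = q + q + 1 + (2 * i + 1) := fun i => by ring
  simp only [this]
  ring

/-- The distribution of a sum over `1, …, 2q` under doubling modulo `2q + 1`. -/
theorem dvd_doubling_sum {R : Type*} [CommRing R] (h b : ℕ → R) (c d e : R) (q : ℕ)
    (hc : ∀ n, 0 < n → n ≤ 2 * q → h (2 * n) = c * h n)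
    (hd : ∀ m, 0 < m → m ≤ 2 * q → d ∣ h (2 * q + 1 + m) - h m - e * b m) :
    d ∣ (c - 1) * ∑ i ∈ range (2 * q), h (i + 1) - e * ∑ i ∈ range q, b (2 * i + 1) := by
  have h1 := sum_range_even_sub_sum_range h q
  rw [sum_congr rfl fun i hi => hc (i + 1) (by omega) (by rw [mem_range] at hi; omega),
    ← mul_sum] at h1
  rw [sub_one_mul, h1, mul_sum, ← sum_sub_distrib]
  exact dvd_sum fun i hi => hd _ (by omega) (by rw [mem_range] at hi; omega)

theorem sq_dvd_add_mul_pow_sub {R : Type*} [CommRing R] (x y p : R) (k : ℕ) :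
    p ^ 2 ∣ (x + p * y) ^ k - x ^ k - p * (k * x ^ (k - 1) * y) := by
  obtain ⟨z, hz⟩ := Polynomial.powAddExpansion x (p * y) k
  exact ⟨z * y ^ 2, by rw [hz]; ring⟩

section Padic

variable {p : ℕ} [Fact p.Prime]

theorem padicInt_isUnit_natCast {n : ℕ} (h : ¬ p ∣ n) : IsUnit (n : ℤ_[p]) := by
  rw [PadicInt.isUnit_iff, PadicInt.norm_natCast_eq_one_iff]
  exact (Nat.Prime.coprime_iff_not_dvd Fact.out).2 h

theorem padicInt_natCast_mul_inv {n : ℕ} (h : ¬ p ∣ n) :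
    (n : ℤ_[p]) * (n : ℤ_[p]).inv = 1 :=
  PadicInt.mul_inv (PadicInt.isUnit_iff.1 (padicInt_isUnit_natCast h))

theorem padicInt_coe_inv_natCast {n : ℕ} (h : ¬ p ∣ n) :
    (((n : ℤ_[p]).inv : ℤ_[p]) : ℚ_[p]) = (n : ℚ_[p])⁻¹ := by
  refine eq_inv_of_mul_eq_one_right ?_
  have := congrArg (fun x : ℤ_[p] => (x : ℚ_[p])) (padicInt_natCast_mul_inv h)
  simpa using this

theorem padicInt_dvd_pow_sub_one {n : ℕ} (h : ¬ p ∣ n) :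
    (p : ℤ_[p]) ∣ (n : ℤ_[p]) ^ (p - 1) - 1 := by
  have h1 : (n : ℤ) ^ (p - 1) ≡ 1 [ZMOD p] :=
    Int.ModEq.pow_card_sub_one_eq_one Fact.out
      (Nat.isCoprime_iff_coprime.2 (((Nat.Prime.coprime_iff_not_dvd Fact.out).2 h).symm))
  have h2 := (PadicInt.pow_p_dvd_int_iff (p := p) 1 ((n : ℤ) ^ (p - 1) - 1)).2
    (by simpa using h1.symm.dvd)
  simpa using h2

theorem padicInt_exists_coe_eq_bernoulli (i : ℕ) (hi : i + 1 < p) :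
    ∃ b : ℤ_[p], (b : ℚ_[p]) = (bernoulli i : ℚ) := by
  induction i using Nat.strong_induction_on with
  | _ i ih =>
    have hs := sum_bernoulli (i + 1)
    rw [sum_range_succ, Nat.choose_succ_self_right] at hs
    have hmem : ∀ k ∈ range i,
        (((i + 1).choose k * bernoulli k : ℚ) : ℚ_[p]) ∈ PadicInt.subring p := by
      intro k hk
      rw [mem_range] at hk
      obtain ⟨b, hb⟩ := ih k hk (by omega)
      push_cast
      rw [← hb]
      exact mul_mem (natCast_mem _ _) b.2
    have hn : ¬ p ∣ i + 1 := Nat.not_dvd_of_pos_of_lt (by omega) hi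
    have hne : ((i + 1 : ℕ) : ℚ) ≠ 0 := by positivity
    have heq : bernoulli i = ((i + 1 : ℕ) : ℚ)⁻¹ * (((if i + 1 = 1 then 1 else 0 : ℕ) : ℚ)
        - ∑ k ∈ range i, ((i + 1).choose k * bernoulli k : ℚ)) := by
      rw [eq_inv_mul_iff_mul_eq₀ hne]
      push_cast at hs ⊢
      linear_combination hs
    have hb : ((bernoulli i : ℚ) : ℚ_[p]) ∈ PadicInt.subring p := by
      rw [heq, Rat.cast_mul, Rat.cast_sub, Rat.cast_sum, Rat.cast_inv, Rat.cast_natCast,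
        Rat.cast_natCast, ← padicInt_coe_inv_natCast hn]
      exact mul_mem (PadicInt.inv _).2 (sub_mem (natCast_mem _ _) (sum_mem hmem))
    exact ⟨⟨_, hb⟩, rfl⟩

/-- `∑_{n < p} n^k ≡ p B_k (mod p²)`. -/
theorem padicInt_sq_dvd_sum_pow_sub (k : ℕ) (hk : 0 < k) (hkp : k + 1 < p) (B : ℤ_[p])
    (hB : (B : ℚ_[p]) = (bernoulli k : ℚ)) :
    (p : ℤ_[p]) ^ 2 ∣ ∑ i ∈ range (p - 1), ((i + 1 : ℕ) : ℤ_[p]) ^ k - p * B := by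
  choose! b hb using fun i (hi : i + 1 < p) => padicInt_exists_coe_eq_bernoulli (p := p) i hi
  have hn : ¬ p ∣ k + 1 := Nat.not_dvd_of_pos_of_lt (by omega) hkp
  have hne : ((k : ℚ) + 1) ≠ 0 := by positivity
  have hsum : ∑ i ∈ range (p - 1), ((i + 1 : ℕ) : ℤ_[p]) ^ k = ∑ i ∈ range p, (i : ℤ_[p]) ^ k := by
    obtain ⟨m, hm⟩ : ∃ m, p = m + 1 := ⟨p - 1, by omega⟩
    rw [show range p = range (m + 1) by rw [hm], show range (p - 1) = range m by rw [hm]; rfl,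
      sum_range_succ']
    simp [hk.ne']
  have hF : (∑ i ∈ range p, (i : ℤ_[p]) ^ k) = ∑ i ∈ range k,
      b i * ((k + 1).choose i) * (p : ℤ_[p]) ^ (k + 1 - i) * ((k + 1 : ℕ) : ℤ_[p]).inv + p * B := by
    apply PadicInt.ext
    have h := congrArg (fun x : ℚ => (x : ℚ_[p])) (sum_range_pow p k)
    beta_reduce at h
    rw [sum_range_succ] at h
    push_cast at h
    simp only [PadicInt.coe_sum, PadicInt.coe_add, PadicInt.coe_mul, PadicInt.coe_pow,
      PadicInt.coe_natCast]
    rw [h, hB]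
    congr 1
    · refine sum_congr rfl fun i hi => ?_
      rw [mem_range] at hi
      rw [padicInt_coe_inv_natCast hn, hb i (by omega)]
      push_cast
      ring
    · have hne' : ((k : ℚ_[p]) + 1) ≠ 0 := by exact_mod_cast hne
      rw [Nat.choose_succ_self_right, Nat.add_sub_cancel_left]
      push_cast
      field_simp
  rw [hsum, hF, add_sub_cancel_right]
  refine dvd_sum fun i hi => ?_
  rw [mem_range] at hi
  exact Dvd.dvd.mul_right (Dvd.dvd.mul_left (pow_dvd_pow _ (by omega)) _) _

theorem padicInt_inv_natCast_eq {n : ℕ} (h : ¬ p ∣ n) {x : ℤ_[p]} (hx : (n : ℤ_[p]) * x = 1) :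
    (n : ℤ_[p]).inv = x := by
  linear_combination x * padicInt_natCast_mul_inv h - (n : ℤ_[p]).inv * hx

theorem padicInt_sq_dvd_sum_inv_pow {q : ℕ} (hq : p = 2 * q + 1) (hq0 : 0 < q) (j : ℕ)
    (hj : 0 < j) :
    (p : ℤ_[p]) ^ 2 ∣ (((2 : ℕ) : ℤ_[p]).inv ^ j - 1)
        * ∑ i ∈ range (2 * q), ((i + 1 : ℕ) : ℤ_[p]).inv ^ j
      - p * ∑ i ∈ range q, -(j * ((2 * i + 1 : ℕ) : ℤ_[p]).inv ^ (j + 1)) := by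
  have hprime : p.Prime := Fact.out
  have h2 : ¬ p ∣ 2 := Nat.not_dvd_of_pos_of_lt (by omega) (by omega)
  have hlt : ∀ n, 0 < n → n ≤ 2 * q → ¬ p ∣ n := fun n h0 hn =>
    Nat.not_dvd_of_pos_of_lt h0 (by omega)
  refine dvd_doubling_sum (fun n => (n : ℤ_[p]).inv ^ j)
    (fun m => -(j * (m : ℤ_[p]).inv ^ (j + 1))) _ _ _ q ?_ ?_
  · intro n h0 hn
    have hn' := hlt n h0 hn
    have : ((2 * n : ℕ) : ℤ_[p]).inv = ((2 : ℕ) : ℤ_[p]).inv * (n : ℤ_[p]).inv := by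
      refine padicInt_inv_natCast_eq (fun h => ?_) ?_
      · exact (hprime.dvd_mul.1 h).elim h2 hn'
      · rw [Nat.cast_mul, mul_mul_mul_comm, padicInt_natCast_mul_inv h2,
          padicInt_natCast_mul_inv hn', one_mul]
    simp only [this, mul_pow]
  · intro m h0 hm
    have hm' := hlt m h0 hm
    have hpm : ¬ p ∣ p + m := fun h => hm' ((Nat.dvd_add_right (dvd_refl p)).1 h)
    rw [← hq]
    set x := (m : ℤ_[p]).inv with hx
    set y := ((p + m : ℕ) : ℤ_[p]).inv with hy
    have e1 : (m : ℤ_[p]) * x = 1 := padicInt_natCast_mul_inv hm'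
    have e2 : ((p : ℤ_[p]) + m) * y = 1 := by
      have := padicInt_natCast_mul_inv hpm
      rwa [← hy, Nat.cast_add] at this
    have e3 : y - (x + p * (-x ^ 2)) = p ^ 2 * (x ^ 2 * y) := by
      linear_combination (x - p * x ^ 2) * e2 + (-y + p * x * y) * e1
    have d1 : (p : ℤ_[p]) ^ 2 ∣ y ^ j - (x + p * (-x ^ 2)) ^ j :=
      (Dvd.intro _ e3.symm).trans (sub_dvd_pow_sub_pow _ _ _)
    have d2 := sq_dvd_add_mul_pow_sub x (-x ^ 2) (p : ℤ_[p]) j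
    convert dvd_add d1 d2 using 1
    obtain ⟨i, rfl⟩ : ∃ i, j = i + 1 := ⟨j - 1, by omega⟩
    rw [Nat.add_sub_cancel]
    ring

theorem padicInt_sq_dvd_sum_pow {q : ℕ} (hq : p = 2 * q + 1) (k : ℕ) :
    (p : ℤ_[p]) ^ 2 ∣ (((2 : ℕ) : ℤ_[p]) ^ k - 1)
        * ∑ i ∈ range (2 * q), ((i + 1 : ℕ) : ℤ_[p]) ^ k
      - p * ∑ i ∈ range q, k * ((2 * i + 1 : ℕ) : ℤ_[p]) ^ (k - 1) := by
  refine dvd_doubling_sum (fun n => (n : ℤ_[p]) ^ k)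
    (fun m => k * (m : ℤ_[p]) ^ (k - 1)) _ _ _ q ?_ ?_
  · intro n _ _
    simp only [Nat.cast_mul, mul_pow]
  · intro m _ _
    rw [← hq]
    have := sq_dvd_add_mul_pow_sub (m : ℤ_[p]) 1 (p : ℤ_[p]) k
    simpa [add_comm] using this

theorem padicInt_isUnit_inv_two_pow_sub_one (hp2 : 2 < p) (i : ℕ) (hi : 0 < i) (hip : 4 ^ i < p) :
    IsUnit (((2 : ℕ) : ℤ_[p]).inv ^ (2 * i) - 1) := by
  have h2 : ((2 : ℕ) : ℤ_[p]) * ((2 : ℕ) : ℤ_[p]).inv = 1 :=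
    padicInt_natCast_mul_inv (Nat.not_dvd_of_pos_of_lt (by omega) hp2)
  have h4 : 1 < 4 ^ i := Nat.one_lt_pow hi.ne' (by norm_num)
  have hu : IsUnit ((4 ^ i - 1 : ℕ) : ℤ_[p]) :=
    padicInt_isUnit_natCast (Nat.not_dvd_of_pos_of_lt (by omega) (by omega))
  have he : ((4 ^ i - 1 : ℕ) : ℤ_[p])
      = -(((2 : ℕ) : ℤ_[p]) ^ (2 * i)) * (((2 : ℕ) : ℤ_[p]).inv ^ (2 * i) - 1) := by
    have h3 : ((2 : ℕ) : ℤ_[p]) ^ (2 * i) * ((2 : ℕ) : ℤ_[p]).inv ^ (2 * i) = 1 := by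
      rw [← mul_pow, h2, one_pow]
    have h5 : ((2 : ℕ) : ℤ_[p]) ^ (2 * i) = 4 ^ i := by rw [pow_mul]; norm_num
    rw [Nat.cast_sub h4.le]
    push_cast at *
    linear_combination h3 - h5
  rw [he] at hu
  exact isUnit_of_mul_isUnit_right hu

theorem padicInt_dvd_sum_inv_pow {q : ℕ} (hq : p = 2 * q + 1) (hq0 : 0 < q) (i : ℕ) (hi : 0 < i)
    (hip : 4 ^ i < p) :
    (p : ℤ_[p]) ∣ ∑ n ∈ range (2 * q), ((n + 1 : ℕ) : ℤ_[p]).inv ^ (2 * i) := by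
  have h := padicInt_sq_dvd_sum_inv_pow hq hq0 (2 * i) (by omega)
  have h1 := (dvd_sub_left (Dvd.intro _ rfl)).1 ((dvd_pow_self (p : ℤ_[p]) two_ne_zero).trans h)
  exact (padicInt_isUnit_inv_two_pow_sub_one (by omega) i hi hip).dvd_mul_left.1 h1

/-- `(2r + 1) ∑_{n < p} n^{-2r} ≡ 2r p B_{p-1-2r} (mod p²)`. -/
theorem padicInt_sq_dvd_sum_inv_pow_sub_bernoulli {q : ℕ} (hq : p = 2 * q + 1) (hq0 : 0 < q)
    (r : ℕ) (hr : 0 < r) (hrp : 4 ^ r < p) (hrp' : 2 * r + 1 < p) (B : ℤ_[p])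
    (hB : (B : ℚ_[p]) = (bernoulli (p - (2 * r + 1)) : ℚ)) :
    (p : ℤ_[p]) ^ 2 ∣
      (2 * r + 1) * ∑ n ∈ range (2 * q), ((n + 1 : ℕ) : ℤ_[p]).inv ^ (2 * r) - 2 * r * p * B := by
  obtain ⟨k, hk⟩ : ∃ k, p = k + 1 + (2 * r + 1) := ⟨p - (2 * r + 1) - 1, by omega⟩
  have hk' : p - (2 * r + 1) = k + 1 := by omega
  have hkc : (k : ℤ_[p]) + 1 + (2 * r + 1) = p := by
    have := congrArg (fun n : ℕ => (n : ℤ_[p])) hk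
    push_cast at this
    exact this.symm
  rw [hk'] at hB
  have cong : ∀ n a b : ℕ, ¬ p ∣ n → a + b = p - 1 →
      (p : ℤ_[p]) ∣ (n : ℤ_[p]) ^ a - (n : ℤ_[p]).inv ^ b := by
    intro n a b hn hab
    have h1 := (padicInt_dvd_pow_sub_one hn).mul_left ((n : ℤ_[p]).inv ^ b)
    have h2 : (n : ℤ_[p]) ^ b * (n : ℤ_[p]).inv ^ b = 1 := by
      rw [← mul_pow, padicInt_natCast_mul_inv hn, one_pow]
    convert h1 using 1
    rw [← hab, pow_add]
    linear_combination (- (n : ℤ_[p]) ^ a) * h2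
  obtain ⟨w1, h1⟩ := padicInt_sq_dvd_sum_inv_pow hq hq0 (2 * r) (by omega)
  obtain ⟨w2, h2⟩ := padicInt_sq_dvd_sum_pow hq (k + 1)
  obtain ⟨w3, h3⟩ := padicInt_sq_dvd_sum_pow_sub (k + 1) (by omega) (by omega) B hB
  obtain ⟨w4, h4⟩ := cong 2 (k + 1) (2 * r)
    (Nat.not_dvd_of_pos_of_lt (by omega) (by omega)) (by omega)
  have h5 : (p : ℤ_[p]) ∣ ∑ i ∈ range q, ((2 * i + 1 : ℕ) : ℤ_[p]) ^ k
      - ∑ i ∈ range q, ((2 * i + 1 : ℕ) : ℤ_[p]).inv ^ (2 * r + 1) := by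
    rw [← sum_sub_distrib]
    refine dvd_sum fun i hi => cong _ _ _ ?_ (by omega)
    rw [mem_range] at hi
    exact Nat.not_dvd_of_pos_of_lt (by omega) (by omega)
  obtain ⟨w5, h5⟩ := h5
  rw [sum_neg_distrib, ← mul_sum] at h1
  rw [← mul_sum, Nat.add_sub_cancel] at h2
  rw [show p - 1 = 2 * q by omega] at h3
  refine (padicInt_isUnit_inv_two_pow_sub_one (by omega) r hr hrp).dvd_mul_left.1 ?_
  generalize ∑ i ∈ range q, ((2 * i + 1 : ℕ) : ℤ_[p]).inv ^ (2 * r + 1) = A at *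
  generalize ∑ i ∈ range q, ((2 * i + 1 : ℕ) : ℤ_[p]) ^ k = A' at *
  generalize ∑ i ∈ range (2 * q), ((i + 1 : ℕ) : ℤ_[p]) ^ (k + 1) = S' at *
  generalize ∑ i ∈ range (2 * q), ((i + 1 : ℕ) : ℤ_[p]).inv ^ (2 * r) = S at *
  generalize ((2 : ℕ) : ℤ_[p]).inv ^ (2 * r) = t at *
  generalize ((2 : ℕ) : ℤ_[p]) ^ (k + 1) = t' at *
  push_cast at h1 h2
  refine ⟨(2 * r + 1) * w1 - 2 * r * (w2 - (t' - 1) * w3 - w4 * B + (k + 1) * w5 + A), ?_⟩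
  linear_combination (2 * r + 1) * h1 - 2 * r * h2 + 2 * r * (t' - 1) * h3 + 2 * r * p * B * h4
    - 2 * r * p * (k + 1) * h5 - 2 * r * p * A * hkc

theorem coe_esymm_inv_eq_cast_Z (m r : ℕ) :
    ((((range (p - 1)).val.map fun n : ℕ => ((n + 1 : ℕ) : ℤ_[p]).inv ^ m).esymm r : ℤ_[p]) : ℚ_[p])
      = ((Z p (List.replicate r m) : ℚ) : ℚ_[p]) := by
  have hp : 0 < p := (Fact.out : p.Prime).pos
  have hI : Icc 1 (p - 1) = (range (p - 1)).map ⟨(· + 1), add_left_injective 1⟩ := by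
    ext x
    simp only [mem_Icc, mem_map, mem_range, Function.Embedding.coeFn_mk]
    exact ⟨fun h => ⟨x - 1, by omega, by omega⟩, by rintro ⟨y, hy, rfl⟩; omega⟩
  rw [Z, ZAux_replicate_eq_esymm (p - 1) m (p - 1) r 1 (by omega), hI]
  change PadicInt.Coe.ringHom _ = Rat.castHom ℚ_[p] _
  rw [← multiset_esymm_map_ringHom, ← multiset_esymm_map_ringHom, map_val, Multiset.map_map,
    Multiset.map_map, Multiset.map_map]
  congr 1
  refine Multiset.map_congr rfl fun n hn => ?_
  have hn' : n < p - 1 := by simpa using hn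
  have := padicInt_coe_inv_natCast (p := p) (n := n + 1)
    (Nat.not_dvd_of_pos_of_lt (by omega) (by omega))
  change (((((n + 1 : ℕ) : ℤ_[p]).inv ^ m : ℤ_[p])) : ℚ_[p])
    = ((((n + 1 : ℕ) : ℚ) ^ m)⁻¹ : ℚ)
  rw [PadicInt.coe_pow, this]
  push_cast
  rw [inv_pow]

theorem congrMod_of_coe_eq_of_dvd {e : ℕ} {α β : ℚ} (x : ℤ_[p])
    (hx : (x : ℚ_[p]) = ((α - β : ℚ) : ℚ_[p])) (h : (p : ℤ_[p]) ^ e ∣ x) : congrMod p e α β := by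
  have h1 := (PadicInt.norm_le_pow_iff_mem_span_pow x e).2 (Ideal.mem_span_singleton.2 h)
  rw [PadicInt.norm_def, hx, Padic.eq_padicNorm] at h1
  unfold congrMod
  rw [← Rat.cast_le (K := ℝ)]
  push_cast
  exact h1

end Padic

/-- Zhou–Cai: `Z_p({2}^r) ≡ (-1)^{r-1} 2 (B_{p-2r-1}/(2r+1)) p (mod p²)` for large primes `p`. -/
theorem stmt5 (r : ℕ) (hr : 0 < r) :
    ∀ᶠ p in Filter.cofinite, p.Prime →
      congrMod p 2 (Z p (List.replicate r 2))
        ((-1 : ℚ) ^ (r - 1) * 2 * (bernoulli (p - (2 * r + 1)) / (2 * r + 1)) * p) := by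
  rw [Nat.cofinite_eq_atTop]
  filter_upwards [Filter.eventually_gt_atTop (4 ^ r + 2 * r + 2)] with p hp hprime
  have : Fact p.Prime := ⟨hprime⟩
  have h4r : 0 < 4 ^ r := by positivity
  obtain ⟨q, hq⟩ : ∃ q, p = 2 * q + 1 := hprime.odd_of_ne_two (by omega)
  have hq0 : 0 < q := by omega
  obtain ⟨B, hB⟩ := padicInt_exists_coe_eq_bernoulli (p := p) (p - (2 * r + 1)) (by omega)
  have h1 := padicInt_sq_dvd_sum_inv_pow_sub_bernoulli hq hq0 r hr (by omega) (by omega) B hB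
  have hu : ∀ i : ℕ, 0 < i → i ≤ r → IsUnit (i : ℤ_[p]) := fun i h0 hi =>
    padicInt_isUnit_natCast (Nat.not_dvd_of_pos_of_lt h0 (by omega))
  have h2 := dvd_finset_esymm_of_dvd_sum_pow (range (p - 1))
    (fun n : ℕ => ((n + 1 : ℕ) : ℤ_[p]).inv ^ 2) (p : ℤ_[p]) r hu
    (fun i h0 hi => by
      simp only [← pow_mul]
      rw [show p - 1 = 2 * q by omega]
      have : 4 ^ i ≤ 4 ^ r := Nat.pow_le_pow_right (by norm_num) hi
      exact padicInt_dvd_sum_inv_pow hq hq0 i h0 (by omega)) hr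
  have hn : ¬ p ∣ 2 * r + 1 := Nat.not_dvd_of_pos_of_lt (by omega) (by omega)
  have h3 := padicInt_natCast_mul_inv hn
  have h4 := padicInt_coe_inv_natCast hn
  refine congrMod_of_coe_eq_of_dvd
    (((range (p - 1)).val.map fun n : ℕ => ((n + 1 : ℕ) : ℤ_[p]).inv ^ 2).esymm r
      - (-1) ^ (r - 1) * 2 * (B * ((2 * r + 1 : ℕ) : ℤ_[p]).inv) * p) ?_ ?_
  · rw [PadicInt.coe_sub, coe_esymm_inv_eq_cast_Z, Rat.cast_sub]
    congr 1
    simp only [PadicInt.coe_mul, PadicInt.coe_pow, PadicInt.coe_neg, PadicInt.coe_one, h4, hB,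
      PadicInt.coe_natCast]
    push_cast
    rw [div_eq_mul_inv]
    rfl
  · refine ((hu r hr le_rfl).mul (padicInt_isUnit_natCast hn)).dvd_mul_left.1 ?_
    simp only [← pow_mul] at h2
    rw [show p - 1 = 2 * q by omega] at h2 ⊢
    convert dvd_add (h2.mul_left (2 * r + 1)) (h1.mul_left ((-1) ^ (r - 1))) using 1
    push_cast at h3 ⊢
    linear_combination (-(r * (-1) ^ (r - 1) * 2 * B * p)) * h3
end

section
/- For every positive integer r, for all but finitely many primes p the following congruence of rational numbers holds modulo p²: Z*_p({2}^r) = ∑_{1 ≤ n₁ ≤ ⋯ ≤ n_r ≤ p−1} 1/(n₁² ⋯ n_r²) is congruent to 2 · (B_{p−2r−1}/(2r+1)) · p modulo p². -/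
/-- The multiple star sum `∑_{a ≤ n₁ ≤ ⋯ ≤ n_r ≤ N} x n₁ ⋯ x n_r` in a commutative ring. -/
def starSum {R : Type*} [CommRing R] (x : ℕ → R) (N : ℕ) : ℕ → ℕ → R
  | 0, _ => 1
  | r + 1, a => ∑ n ∈ Finset.Icc a N, x n * starSum x N r n

lemma map_starSum {R S : Type*} [CommRing R] [CommRing S] (f : R →+* S) (x : ℕ → R)
    (N r a : ℕ) : f (starSum x N r a) = starSum (fun n => f (x n)) N r a := by
  induction r generalizing a with
  | zero => simp [starSum]
  | succ r ih => simp [starSum, ih]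

lemma ZsAux_replicate_two (N r a : ℕ) :
    ZsAux N (List.replicate r 2) a = starSum (fun n : ℕ => ((n : ℚ)⁻¹) ^ 2) N r a := by
  induction r generalizing a with
  | zero => simp [starSum, ZsAux]
  | succ r ih => simp [starSum, ZsAux, List.replicate_succ, ih]

lemma starSum_congr {R : Type*} [CommRing R] {x y : ℕ → R} {N b : ℕ}
    (h : ∀ n, b ≤ n → n ≤ N → x n = y n) (r : ℕ) {a : ℕ} (ha : b ≤ a) :
    starSum x N r a = starSum y N r a := by
  induction r generalizing a with
  | zero => rfl
  | succ r ih =>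
    refine Finset.sum_congr rfl fun n hn => ?_
    rw [Finset.mem_Icc] at hn
    rw [h n (ha.trans hn.1) hn.2, ih (ha.trans hn.1)]

lemma starSum_succ_of_le {R : Type*} [CommRing R] (x : ℕ → R) {N a : ℕ} (ha : a ≤ N) (r : ℕ) :
    starSum x N (r + 1) a = x a * starSum x N r a + starSum x N (r + 1) (a + 1) := by
  simp only [starSum]
  rw [← Finset.add_sum_Ioc_eq_sum_Icc ha, Finset.Icc_add_one_left_eq_Ioc]

section Newton

open PowerSeries

variable {R : Type*} [CommRing R]

lemma newton_series (x : ℕ → R) (N a : ℕ) (ha : a ≤ N + 1) :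
    (mk fun j : ℕ => (j : R) * starSum x N j a) =
      (mk fun i : ℕ => if i = 0 then 0 else ∑ n ∈ Finset.Icc a N, x n ^ i) *
        mk fun j : ℕ => starSum x N j a := by
  induction ha using Nat.decreasingInduction with
  | self =>
    ext j
    have h : (mk fun i : ℕ => if i = 0 then (0 : R) else
        ∑ n ∈ Finset.Icc (N + 1) N, x n ^ i) = 0 := by
      ext i; simp
    rw [h]
    cases j <;> simp [starSum]
  | @of_succ a ha ih =>
    have ha' : a ≤ N := by omega
    have hH : (1 - C (x a) * X) * (mk fun j : ℕ => starSum x N j a) =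
        mk fun j : ℕ => starSum x N j (a + 1) := by
      ext j
      cases j with
      | zero => simp [sub_mul, starSum, mul_assoc]
      | succ j =>
        simp [sub_mul, mul_assoc, coeff_succ_X_mul, starSum_succ_of_le x ha']
    have hE : (1 - C (x a) * X) * (mk fun j : ℕ => (j : R) * starSum x N j a) =
        (mk fun j : ℕ => (j : R) * starSum x N j (a + 1)) +
          C (x a) * X * mk fun j : ℕ => starSum x N j a := by
      ext j
      cases j with
      | zero => simp [sub_mul, mul_assoc]
      | succ j =>
        simp [sub_mul, mul_assoc, coeff_succ_X_mul, starSum_succ_of_le x ha']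
        ring
    have hP : (1 - C (x a) * X) * (mk fun i : ℕ => if i = 0 then 0 else
          ∑ n ∈ Finset.Icc a N, x n ^ i) =
        (1 - C (x a) * X) * (mk fun i : ℕ => if i = 0 then 0 else
          ∑ n ∈ Finset.Icc (a + 1) N, x n ^ i) + C (x a) * X := by
      have hs : ∀ i, ∑ n ∈ Finset.Icc a N, x n ^ i =
          x a ^ i + ∑ n ∈ Finset.Icc (a + 1) N, x n ^ i := fun i => by
        rw [← Finset.add_sum_Ioc_eq_sum_Icc ha', Finset.Icc_add_one_left_eq_Ioc]
      ext j
      rcases j with _ | _ | j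
      · simp [sub_mul, mul_assoc]
      · simp [sub_mul, mul_assoc, coeff_succ_X_mul, hs, add_comm]
      · simp [sub_mul, mul_assoc, coeff_succ_X_mul, hs]
        ring
    have hu : IsUnit (1 - C (x a) * X : R⟦X⟧) := by
      rw [isUnit_iff_constantCoeff]; simp
    apply hu.mul_left_cancel
    rw [hE, ih, ← hH, ← mul_assoc (1 - C (x a) * X), hP]
    ring

/-- Newton's identity relating complete homogeneous sums and power sums. -/
lemma newton_starSum (x : ℕ → R) (N j : ℕ) :
    (j : R) * starSum x N j 1 = ∑ i ∈ Finset.range j,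
      (∑ n ∈ Finset.Icc 1 N, x n ^ (i + 1)) * starSum x N (j - (i + 1)) 1 := by
  have h := congrArg (coeff j) (newton_series x N 1 (by omega))
  rw [coeff_mk, coeff_mul, Finset.Nat.sum_antidiagonal_eq_sum_range_succ_mk,
    Finset.sum_range_succ'] at h
  simpa using h

end Newton

lemma sum_Icc_eq_sum_reflect {R : Type*} [AddCommMonoid R] (F : ℕ → R) (h : ℕ) :
    ∑ n ∈ Finset.Icc 1 (2 * h), F n =
      ∑ j ∈ Finset.Icc 1 h, (F j + F (2 * h + 1 - j)) := by
  rw [Finset.sum_add_distrib]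
  have e : Finset.Icc 1 (2 * h) = Finset.Icc 1 h ∪ Finset.Icc (h + 1) (2 * h) := by
    ext; simp; omega
  rw [e, Finset.sum_union (by rw [Finset.disjoint_left]; intro a; simp; omega)]
  congr 1
  refine Finset.sum_nbij' (fun n => 2 * h + 1 - n) (fun n => 2 * h + 1 - n) ?_ ?_ ?_ ?_ ?_
  all_goals intro a ha
  all_goals simp only [Finset.mem_Icc] at *
  · omega
  · omega
  · omega
  · omega
  · congr 1; omega

lemma sum_Icc_eq_sum_even_reflect {R : Type*} [AddCommMonoid R] (F : ℕ → R) (h : ℕ) :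
    ∑ n ∈ Finset.Icc 1 (2 * h), F n =
      ∑ j ∈ Finset.Icc 1 h, (F (2 * j) + F (2 * h + 1 - 2 * j)) := by
  rw [Finset.sum_add_distrib, ← Finset.sum_filter_add_sum_filter_not _ (fun n => 2 ∣ n)]
  congr 1
  · refine Finset.sum_nbij' (fun n => n / 2) (fun n => 2 * n) ?_ ?_ ?_ ?_ ?_
    all_goals intro a ha
    all_goals simp only [Finset.mem_Icc, Finset.mem_filter] at *
    · omega
    · omega
    · omega
    · omega
    · congr 1; omega
  · refine Finset.sum_nbij' (fun n => (2 * h + 1 - n) / 2) (fun n => 2 * h + 1 - 2 * n)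
      ?_ ?_ ?_ ?_ ?_
    all_goals intro a ha
    all_goals simp only [Finset.mem_Icc, Finset.mem_filter] at *
    · omega
    · omega
    · omega
    · omega
    · congr 1; omega

lemma two_mul_add_two_le_four_pow {r : ℕ} (hr : 0 < r) : 2 * r + 2 ≤ 4 ^ r := by
  induction r, hr using Nat.le_induction with
  | base => norm_num
  | succ r hr ih => rw [pow_succ]; omega

section SquareZero

variable {R : Type*} [CommRing R]

lemma add_pow_succ_of_sq_zero {e : R} (he : e ^ 2 = 0) (y z : R) (m : ℕ) :
    (y + e * z) ^ (m + 1) = y ^ (m + 1) + (m + 1) * e * (y ^ m * z) := by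
  induction m with
  | zero => simp
  | succ m ih =>
    rw [pow_succ, ih]
    push_cast
    linear_combination ((m + 1) * y ^ m * z ^ 2) * he

lemma isUnit_natCast_of_sq_zero {p : ℕ} (hp : p.Prime) (he : (p : R) ^ 2 = 0) {n : ℕ}
    (hn : ¬ p ∣ n) : IsUnit (n : R) := by
  have hc : IsCoprime (n : ℤ) ((p : ℤ) ^ 2) := by
    apply IsCoprime.pow_right
    exact Nat.isCoprime_iff_coprime.2 ((hp.coprime_iff_not_dvd.2 hn).symm)
  obtain ⟨a, b, hab⟩ := hc
  have := congrArg (Int.cast : ℤ → R) hab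
  push_cast at this
  rw [he, mul_zero, add_zero] at this
  exact IsUnit.of_mul_eq_one (a : R) (by rw [mul_comm]; exact this)

lemma natCast_pow_sub_one {p : ℕ} (hp : p.Prime) {n : ℕ} (hn : ¬ p ∣ n) :
    ∃ c : R, (n : R) ^ (p - 1) = 1 + p * c := by
  have h : (p : ℤ) ∣ (n : ℤ) ^ (p - 1) - 1 := by
    have := Int.ModEq.pow_card_sub_one_eq_one hp (n := (n : ℤ))
      (Nat.isCoprime_iff_coprime.2 ((hp.coprime_iff_not_dvd.2 hn).symm))
    exact this.symm.dvd
  obtain ⟨c, hc⟩ := h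
  have := congrArg (Int.cast : ℤ → R) hc
  push_cast at this
  exact ⟨c, by linear_combination this⟩

lemma natCast_mul_pow_sub_one {p : ℕ} (hp : p.Prime) (he : (p : R) ^ 2 = 0) {n : ℕ}
    (hn : ¬ p ∣ n) : (p : R) * (n : R) ^ (p - 1) = p := by
  obtain ⟨c, hc⟩ := natCast_pow_sub_one (R := R) hp hn
  linear_combination (p : R) * hc + c * he

/-- Comparing a sum over `1 ≤ n < p` with its evaluation along even numbers, for a function
which is multiplicative under doubling and has a first order expansion at `p - j`. -/
lemma doubling_sum {p h : ℕ} (hph : p = 2 * h + 1) (F G : ℕ → R) (k c d : R)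
    (hF : ∀ j, 1 ≤ j → j < p → F (p - j) = F j - k * p * G j)
    (hF2 : ∀ j, 1 ≤ j → 2 * j < p → F (2 * j) = c * F j)
    (hG2 : ∀ j, 1 ≤ j → 2 * j < p → G (2 * j) = d * G j) :
    (c - 1) * ∑ n ∈ Finset.Icc 1 (p - 1), F n =
      k * p * ((d - c) * ∑ j ∈ Finset.Icc 1 h, G j) := by
  have h1 : ∑ n ∈ Finset.Icc 1 (p - 1), F n =
      2 * ∑ j ∈ Finset.Icc 1 h, F j - k * p * ∑ j ∈ Finset.Icc 1 h, G j := by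
    have : p - 1 = 2 * h := by omega
    rw [this, sum_Icc_eq_sum_reflect, ← hph, Finset.mul_sum, Finset.mul_sum,
      ← Finset.sum_sub_distrib]
    refine Finset.sum_congr rfl fun j hj => ?_
    rw [Finset.mem_Icc] at hj
    rw [hF j hj.1 (by omega)]
    ring
  have h2 : ∑ n ∈ Finset.Icc 1 (p - 1), F n =
      2 * c * ∑ j ∈ Finset.Icc 1 h, F j - k * p * d * ∑ j ∈ Finset.Icc 1 h, G j := by
    have : p - 1 = 2 * h := by omega
    rw [this, sum_Icc_eq_sum_even_reflect, ← hph, Finset.mul_sum, Finset.mul_sum,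
      ← Finset.sum_sub_distrib]
    refine Finset.sum_congr rfl fun j hj => ?_
    rw [Finset.mem_Icc] at hj
    rw [hF (2 * j) (by omega) (by omega), hF2 j hj.1 (by omega), hG2 j hj.1 (by omega)]
    ring
  linear_combination c * h1 - h2

lemma inverse_power_sum {p r : ℕ} (hp : p.Prime) (hr : 0 < r) (hpr : 4 ^ r < p)
    (he : (p : R) ^ 2 = 0) (u : ℕ → R) (hu : ∀ n, 1 ≤ n → n < p → (n : R) * u n = 1) :
    (p : R) ∣ ∑ n ∈ Finset.Icc 1 (p - 1), (u n ^ 2) ^ r ∧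
    (2 * r + 1) * ∑ n ∈ Finset.Icc 1 (p - 1), (u n ^ 2) ^ r =
      2 * r * ∑ n ∈ Finset.Icc 1 (p - 1), (n : R) ^ (p - (2 * r + 1)) := by
  have h4r := two_mul_add_two_le_four_pow hr
  obtain ⟨h, hph⟩ : ∃ h, p = 2 * h + 1 := hp.odd_of_ne_two (by omega)
  obtain ⟨m, hm⟩ : ∃ m, p - (2 * r + 1) = m + 1 := ⟨p - (2 * r + 1) - 1, by omega⟩
  have hm2 : Even (m + 1) := ⟨h - r, by omega⟩
  have hcast : ∀ j, j < p → ((p - j : ℕ) : R) = p - j := fun j hj => by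
    rw [Nat.cast_sub hj.le]
  have hnd : ∀ n, 1 ≤ n → n < p → ¬ p ∣ n := fun n h1 h2 => Nat.not_dvd_of_pos_of_lt h1 h2
  have hunit : ∀ n, 1 ≤ n → n < p → IsUnit (n : R) := fun n h1 h2 =>
    isUnit_natCast_of_sq_zero hp he (hnd n h1 h2)
  have hu2 := hu 2 (by omega) (by omega)
  push_cast at hu2
  have hurefl : ∀ j, 1 ≤ j → j < p → u (p - j) = -(u j + p * u j ^ 2) := fun j h1 h2 => by
    apply (hunit (p - j) (by omega) (by omega)).mul_left_cancel
    rw [hu (p - j) (by omega) (by omega), hcast j h2]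
    linear_combination (-1 - p * u j) * hu j h1 h2 + u j ^ 2 * he
  have hudbl : ∀ j, 1 ≤ j → 2 * j < p → u (2 * j) = u 2 * u j := fun j h1 h2 => by
    apply (hunit (2 * j) (by omega) (by omega)).mul_left_cancel
    rw [hu (2 * j) (by omega) (by omega)]
    push_cast
    linear_combination -hu2 - 2 * u 2 * hu j h1 (by omega)
  have hup : ∀ j, 1 ≤ j → j < p → (p : R) * u j ^ (2 * r + 1) = p * (j : R) ^ m :=
    fun j h1 h2 => by
    have e1 := natCast_mul_pow_sub_one (R := R) hp he (hnd j h1 h2)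
    have e2 : p - 1 = m + (2 * r + 1) := by omega
    rw [e2, pow_add] at e1
    have e3 : (j : R) ^ (2 * r + 1) * u j ^ (2 * r + 1) = 1 := by
      rw [← mul_pow, hu j h1 h2, one_pow]
    linear_combination (-u j ^ (2 * r + 1)) * e1 + p * (j : R) ^ m * e3
  -- the sum of inverse powers
  have A := doubling_sum (R := R) hph (fun n => (u n ^ 2) ^ r) (fun n => u n ^ (2 * r + 1))
    (-(2 * r)) (u 2 ^ (2 * r)) (u 2 ^ (2 * r + 1))
    (fun j h1 h2 => by
      obtain ⟨s, hs⟩ : ∃ s, 2 * r = s + 1 := ⟨2 * r - 1, by omega⟩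
      have hs' : (2 * r : R) = s + 1 := by exact_mod_cast congrArg (Nat.cast : ℕ → R) hs
      simp only [← pow_mul]
      rw [hurefl j h1 h2, (even_two_mul r).neg_pow, hs', hs, add_pow_succ_of_sq_zero he]
      ring)
    (fun j h1 h2 => by simp only [← pow_mul]; rw [hudbl j h1 h2, mul_pow])
    (fun j h1 h2 => by rw [hudbl j h1 h2, mul_pow])
  -- the sum of positive powers
  have B := doubling_sum (R := R) hph (fun n => (n : R) ^ (m + 1)) (fun n => (n : R) ^ m)
    (m + 1) (2 ^ (m + 1)) (2 ^ m)
    (fun j h1 h2 => by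
      have := add_pow_succ_of_sq_zero he (-(j : R)) 1 m
      rw [hcast j h2, sub_eq_neg_add, ← mul_one (p : R), this, hm2.neg_pow]
      have hodd : Odd m := by rcases hm2 with ⟨t, ht⟩; exact ⟨t - 1, by omega⟩
      rw [hodd.neg_pow]
      ring)
    (fun j h1 h2 => by push_cast; rw [mul_pow])
    (fun j h1 h2 => by push_cast; rw [mul_pow])
  have hc : IsUnit (u 2 ^ (2 * r) - 1) := by
    have h1 : IsUnit ((4 ^ r - 1 : ℕ) : R) := hunit _ (by omega) (by omega)
    have h2 : (2 : R) ^ (2 * r) * u 2 ^ (2 * r) = 1 := by rw [← mul_pow, hu2, one_pow]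
    have h3 : u 2 ^ (2 * r) - 1 = -(((4 ^ r - 1 : ℕ) : R) * u 2 ^ (2 * r)) := by
      rw [Nat.cast_sub (by omega)]
      push_cast
      rw [pow_mul] at h2
      norm_num at h2
      linear_combination h2
    rw [h3]
    exact (h1.mul (IsUnit.of_mul_eq_one _ (by rw [mul_comm]; exact h2))).neg
  have hSdvd : (p : R) ∣ ∑ n ∈ Finset.Icc 1 (p - 1), (u n ^ 2) ^ r := by
    rw [← hc.dvd_mul_left, A]
    exact ⟨_, by rw [mul_comm (-(2 * r : R)), mul_assoc]⟩
  refine ⟨hSdvd, ?_⟩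
  rw [hm]
  have hp2 : (p : R) * 2 ^ m = p * u 2 ^ (2 * r + 1) := by
    have := hup 2 (by omega) (by omega)
    push_cast at this
    exact this.symm
  have hp2' : (p : R) * 2 ^ (m + 1) = p * u 2 ^ (2 * r) := by
    linear_combination 2 * hp2 + p * u 2 ^ (2 * r) * hu2
  have hG : (p : R) * ∑ j ∈ Finset.Icc 1 h, (j : R) ^ m =
      p * ∑ j ∈ Finset.Icc 1 h, u j ^ (2 * r + 1) := by
    rw [Finset.mul_sum, Finset.mul_sum]
    refine Finset.sum_congr rfl fun j hj => ?_
    rw [Finset.mem_Icc] at hj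
    exact (hup j hj.1 (by omega)).symm
  have hTdvd : (p : R) ∣ ∑ n ∈ Finset.Icc 1 (p - 1), (n : R) ^ (m + 1) := by
    obtain ⟨w, hw⟩ := natCast_pow_sub_one (R := R) hp (hnd 2 (by omega) (by omega))
    have e2 : p - 1 = m + 1 + 2 * r := by omega
    rw [e2, pow_add] at hw
    push_cast at hw
    have h2 : (2 : R) ^ (2 * r) * u 2 ^ (2 * r) = 1 := by rw [← mul_pow, hu2, one_pow]
    have h3 : u 2 ^ (2 * r) - 1 = (2 ^ (m + 1) - 1) - p * (w * u 2 ^ (2 * r)) := by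
      linear_combination 2 ^ (m + 1) * h2 - u 2 ^ (2 * r) * hw
    rw [← hc.dvd_mul_left, h3, sub_mul, B]
    exact ⟨(m + 1) * ((2 ^ m - 2 ^ (m + 1)) * ∑ j ∈ Finset.Icc 1 h, (j : R) ^ m) -
      w * u 2 ^ (2 * r) * ∑ n ∈ Finset.Icc 1 (p - 1), (n : R) ^ (m + 1), by ring⟩
  have hmc : (m + 1 : R) = p - (2 * r + 1) := by
    have : ((p - (2 * r + 1) : ℕ) : R) = ((m + 1 : ℕ) : R) := by rw [hm]
    rw [Nat.cast_sub (by omega)] at this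
    push_cast at this
    exact this.symm
  obtain ⟨t, ht⟩ := hTdvd
  apply hc.mul_left_cancel
  set U := ∑ j ∈ Finset.Icc 1 h, u j ^ (2 * r + 1)
  set V := ∑ j ∈ Finset.Icc 1 h, (j : R) ^ m
  rw [hmc] at B
  have B' : (u 2 ^ (2 * r) - 1) * ∑ n ∈ Finset.Icc 1 (p - 1), (n : R) ^ (m + 1) =
      -(2 * r + 1) * p * ((u 2 ^ (2 * r + 1) - u 2 ^ (2 * r)) * U) := by
    rw [ht] at B ⊢
    linear_combination B - t * hp2' + (2 ^ m - 2 ^ (m + 1)) * V * he -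
      (2 * r + 1) * V * (hp2 - hp2') -
      (2 * r + 1) * (u 2 ^ (2 * r + 1) - u 2 ^ (2 * r)) * hG
  linear_combination (2 * r + 1) * A - 2 * r * B'

end SquareZero

section SquareZeroStar

variable {R : Type*} [CommRing R]

lemma star_two_eq {p r : ℕ} (hp : p.Prime) (hr : 0 < r) (hpr : 4 ^ r < p)
    (he : (p : R) ^ 2 = 0) (u : ℕ → R) (hu : ∀ n, 1 ≤ n → n < p → (n : R) * u n = 1) :
    (2 * r + 1) * starSum (fun n => u n ^ 2) (p - 1) r 1 =
      2 * ∑ n ∈ Finset.Icc 1 (p - 1), (n : R) ^ (p - (2 * r + 1)) := by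
  have hlt : ∀ j, j ≤ r → j < p := fun j hj =>
    (hj.trans_lt (Nat.lt_pow_self (by norm_num : 1 < 4))).trans hpr
  have hunit : ∀ j, 0 < j → j ≤ r → IsUnit (j : R) := fun j h1 h2 =>
    isUnit_natCast_of_sq_zero hp he (Nat.not_dvd_of_pos_of_lt h1 (hlt j h2))
  have hP : ∀ j, 0 < j → j ≤ r →
      (p : R) ∣ ∑ n ∈ Finset.Icc 1 (p - 1), (u n ^ 2) ^ j := fun j h1 h2 =>
    (inverse_power_sum hp h1 ((Nat.pow_le_pow_right (by norm_num) h2).trans_lt hpr) he u hu).1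
  have hH : ∀ j, 0 < j → j ≤ r → (p : R) ∣ starSum (fun n => u n ^ 2) (p - 1) j 1 := by
    intro j h1 h2
    rw [← (hunit j h1 h2).dvd_mul_left, newton_starSum]
    refine Finset.dvd_sum fun i hi => Dvd.dvd.mul_right (hP (i + 1) (by omega) ?_) _
    rw [Finset.mem_range] at hi
    omega
  have hN : (r : R) * starSum (fun n => u n ^ 2) (p - 1) r 1 =
      ∑ n ∈ Finset.Icc 1 (p - 1), (u n ^ 2) ^ r := by
    obtain ⟨s, rfl⟩ : ∃ s, r = s + 1 := ⟨r - 1, by omega⟩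
    rw [newton_starSum, Finset.sum_range_succ, Finset.sum_eq_zero, zero_add]
    · simp [starSum]
    · intro i hi
      rw [Finset.mem_range] at hi
      obtain ⟨a, ha⟩ := hP (i + 1) (by omega) (by omega)
      obtain ⟨b, hb⟩ := hH (s + 1 - (i + 1)) (by omega) (by omega)
      rw [ha, hb]
      linear_combination (a * b) * he
  have h := (inverse_power_sum hp hr hpr he u hu).2
  apply (hunit r hr le_rfl).mul_left_cancel
  linear_combination (2 * r + 1) * hN + h

end SquareZeroStar

/-- The subring of `ℚ` of `p`-integral rationals. -/
def pIntegral (p : ℕ) [Fact p.Prime] : Subring ℚ where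
  carrier := {x | padicNorm p x ≤ 1}
  mul_mem' {a b} ha hb := by
    simp only [Set.mem_ofPred_eq] at *
    rw [padicNorm.mul]
    exact mul_le_one₀ ha (padicNorm.nonneg b) hb
  one_mem' := by simp
  add_mem' {a b} ha hb := padicNorm.nonarchimedean.trans (max_le ha hb)
  zero_mem' := by simp
  neg_mem' {a} ha := by simpa using ha

section PIntegral

variable {p : ℕ} [hp : Fact p.Prime]

lemma mem_pIntegral {x : ℚ} : x ∈ pIntegral p ↔ padicNorm p x ≤ 1 := Iff.rfl

lemma inv_natCast_mem_pIntegral {n : ℕ} (hn : ¬ p ∣ n) : (n : ℚ)⁻¹ ∈ pIntegral p := by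
  rw [mem_pIntegral, ← one_div, padicNorm.div, (padicNorm.nat_eq_one_iff n).2 hn]
  simp

lemma bernoulli_mem_pIntegral {n : ℕ} (hn : n + 1 < p) : bernoulli n ∈ pIntegral p := by
  induction n using Nat.strong_induction_on with
  | _ n ih =>
    have h := sum_bernoulli (n + 1)
    rw [Finset.sum_range_succ] at h
    have hn0 : ((n + 1 : ℕ) : ℚ) ≠ 0 := by positivity
    have e : bernoulli n = ((n + 1 : ℕ) : ℚ)⁻¹ * ((if n + 1 = 1 then 1 else 0) -
        ∑ k ∈ Finset.range n, ((n + 1).choose k : ℚ) * bernoulli k) := by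
      rw [← h, Nat.choose_succ_self_right]
      field_simp
      ring
    rw [e]
    refine mul_mem (inv_natCast_mem_pIntegral
      (Nat.not_dvd_of_pos_of_lt (by omega) hn)) (sub_mem ?_ (sum_mem fun k hk => ?_))
    · split_ifs
      exacts [one_mem _, zero_mem _]
    · rw [Finset.mem_range] at hk
      exact mul_mem (natCast_mem _ _) (ih k hk (by omega))

lemma congrMod_of_natCast_mul_sub {e n : ℕ} (hn : ¬ p ∣ n) {x y : ℚ} (z : pIntegral p)
    (h : (n : ℚ) * (x - y) = p ^ e * z) : congrMod p e x y := by
  have h' := congrArg (padicNorm p) h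
  have hpow : padicNorm p ((p : ℚ) ^ e) = (p : ℚ) ^ (-(e : ℤ)) := by
    clear h h'
    induction e with
    | zero => simp
    | succ e ih =>
      rw [pow_succ, padicNorm.mul, ih, padicNorm.padicNorm_p_of_prime]
      rw [zpow_neg, zpow_neg, zpow_natCast, zpow_natCast, pow_succ, mul_inv]
  rw [padicNorm.mul, padicNorm.mul, (padicNorm.nat_eq_one_iff n).2 hn, one_mul, hpow] at h'
  rw [congrMod, h']
  exact mul_le_of_le_one_right (by positivity) z.2

/-- Faulhaber's formula modulo `p²`, for exponents below `p - 1`. -/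
lemma map_power_sum_eq {R : Type*} [CommRing R] (he : (p : R) ^ 2 = 0)
    (f : pIntegral p →+* R) {m : ℕ} (hm0 : 0 < m) (hm : m + 1 < p) :
    ∑ n ∈ Finset.Icc 1 (p - 1), (n : R) ^ m =
      p * f ⟨bernoulli m, bernoulli_mem_pIntegral hm⟩ := by
  let b : ℕ → pIntegral p := fun k =>
    if hk : k + 1 < p then ⟨bernoulli k, bernoulli_mem_pIntegral hk⟩ else 0
  have hb : ∀ k, k ≤ m → (b k : ℚ) = bernoulli k := fun k hk => by
    simp [b, show k + 1 < p by omega]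
  have hbm : b m = ⟨bernoulli m, bernoulli_mem_pIntegral hm⟩ := by simp [b, hm]
  have key : ((m + 1 : ℕ) : pIntegral p) * ∑ n ∈ Finset.range p, (n : pIntegral p) ^ m =
      ∑ k ∈ Finset.range (m + 1), b k * ((m + 1).choose k : pIntegral p) *
        (p : pIntegral p) ^ (m + 1 - k) := by
    apply Subtype.ext
    push_cast
    rw [sum_range_pow, Finset.mul_sum]
    refine Finset.sum_congr rfl fun k hk => ?_
    rw [Finset.mem_range] at hk
    rw [hb k (by omega)]
    field_simp
  have key' := congrArg f key
  rw [Finset.sum_range_succ] at key'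
  simp only [map_mul, map_add, map_sum, map_pow, map_natCast] at key'
  rw [Finset.sum_eq_zero (s := Finset.range m), zero_add, hbm, Nat.choose_succ_self_right] at key'
  · have hr : Finset.range p = insert 0 (Finset.Icc 1 (p - 1)) := by
      ext; simp; omega
    rw [hr, Finset.sum_insert (by simp), Nat.cast_zero, zero_pow hm0.ne', zero_add] at key'
    apply (isUnit_natCast_of_sq_zero hp.out he
      (Nat.not_dvd_of_pos_of_lt (Nat.succ_pos m) hm)).mul_left_cancel
    rw [key', show m + 1 - m = 1 by omega]
    ring
  · intro k hk
    rw [Finset.mem_range] at hk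
    rw [show m + 1 - k = 2 + (m - 1 - k) by omega, pow_add, he]
    simp

end PIntegral

/-- `Z*_p({2}^r) ≡ 2 (B_{p-2r-1}/(2r+1)) p (mod p²)` for large primes `p`. -/
theorem stmt6 (r : ℕ) (hr : 0 < r) :
    ∀ᶠ p in Filter.cofinite, p.Prime →
      congrMod p 2 (Zstar p (List.replicate r 2))
        (2 * (bernoulli (p - (2 * r + 1)) / (2 * r + 1)) * p) := by
  have hfin : {p : ℕ | p ≤ 4 ^ r}.Finite := Set.finite_le_nat _
  filter_upwards [hfin.compl_mem_cofinite] with p hpr hp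
  replace hpr : 4 ^ r < p := by simpa using hpr
  have : Fact p.Prime := ⟨hp⟩
  have h4r : 2 * r + 2 ≤ 4 ^ r := two_mul_add_two_le_four_pow hr
  let I : Ideal (pIntegral p) := Ideal.span {(p : pIntegral p) ^ 2}
  let f : pIntegral p →+* pIntegral p ⧸ I := Ideal.Quotient.mk I
  have he : ((p : ℕ) : pIntegral p ⧸ I) ^ 2 = 0 := by
    rw [← map_natCast f, ← map_pow]
    exact Ideal.Quotient.eq_zero_iff_mem.2 (Ideal.mem_span_singleton_self _)
  let u : ℕ → pIntegral p := fun n =>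
    if hn : p ∣ n then 0 else ⟨(n : ℚ)⁻¹, inv_natCast_mem_pIntegral hn⟩
  have hndvd : ∀ n, 1 ≤ n → n < p → ¬ p ∣ n := fun n h1 h2 => Nat.not_dvd_of_pos_of_lt h1 h2
  have huq : ∀ n, ((u n : pIntegral p) : ℚ) = if p ∣ n then 0 else (n : ℚ)⁻¹ := fun n => by
    by_cases hn : p ∣ n <;> simp [u, hn]
  have hu : ∀ n, 1 ≤ n → n < p → ((n : ℕ) : pIntegral p ⧸ I) * f (u n) = 1 := by
    intro n h1 h2
    rw [← map_natCast f, ← map_mul, ← map_one f]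
    congr 1
    apply Subtype.ext
    have : (n : ℚ) ≠ 0 := by positivity
    simp [huq, hndvd n h1 h2, this]
  have hm : p - (2 * r + 1) + 1 < p := by omega
  have hstar := star_two_eq hp hr hpr he (fun n => f (u n)) hu
  rw [map_power_sum_eq he f (by omega) hm] at hstar
  set b : pIntegral p := ⟨bernoulli (p - (2 * r + 1)), bernoulli_mem_pIntegral hm⟩ with hb
  have hmap := map_starSum f (fun n => u n ^ 2) (p - 1) r 1
  simp only [map_pow] at hmap
  rw [← hmap] at hstar
  have hmem : ((2 * r + 1 : ℕ) : pIntegral p) * starSum (fun n => u n ^ 2) (p - 1) r 1 -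
      2 * (p * b) ∈ I := by
    rw [← Ideal.Quotient.eq_zero_iff_mem]
    change f _ = 0
    simp only [map_sub, map_mul, map_natCast, map_ofNat]
    push_cast
    rw [hstar, sub_self]
  obtain ⟨z, hz⟩ := Ideal.mem_span_singleton.1 hmem
  refine congrMod_of_natCast_mul_sub (n := 2 * r + 1)
    (hndvd _ (by omega) (by omega)) z ?_
  have hZ : ((starSum (fun n => u n ^ 2) (p - 1) r 1 : pIntegral p) : ℚ) =
      Zstar p (List.replicate r 2) := by
    rw [Zstar, ZsAux_replicate_two]
    have := map_starSum (pIntegral p).subtype (fun n => u n ^ 2) (p - 1) r 1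
    rw [Subring.subtype_apply] at this
    rw [this]
    refine starSum_congr (fun n h1 h2 => ?_) r le_rfl
    simp [huq, hndvd n h1 (by omega)]
  have hz' := congrArg (Subtype.val : pIntegral p → ℚ) hz
  have h2 : ((2 : pIntegral p) : ℚ) = 2 := rfl
  push_cast at hz'
  rw [hZ, h2] at hz'
  rw [← hz']
  push_cast
  field_simp
  simp only [hb]
  ring
end
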